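/- arXiv:1302.0133 — 2 statements merged into one kernel-verified Lean document; each statement's English description precedes it below -/
import Mathlib

section
/- Let n, m ≥ 2, s = (m+1)/2 (so m is odd) and r ≠ (n+1)/2. With R = ℤ[x₁,x₂]/⟨x₁·∏_{i=1}^n (x₁ + b_i·x₂), x₂·∏_{j=1}^m (a_j·x₁ + x₂)⟩ where b has r ones and a has s twos (rest zeros), the group of graded ring automorphisms of R is exactly {I, −I, (1,0;−2,−1), (−1,0;2,1)} ≅ ℤ/2 × ℤ/2. -/
open MvPolynomial

/-- `R = ℤ[x₁,x₂]/⟨x₁·∏ᵢ(x₁+bᵢx₂), x₂·∏ⱼ(aⱼx₁+x₂)⟩`, the integral cohomology ring of a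
quasitoric manifold over `Δⁿ × Δᵐ`, generators in degree 2. -/
noncomputable abbrev RM (n m : ℕ) (a : Fin m → ℤ) (b : Fin n → ℤ) : Type :=
  MvPolynomial (Fin 2) ℤ ⧸
    Ideal.span ({X 0 * ∏ i : Fin n, (X 0 + C (b i) * X 1),
      X 1 * ∏ j : Fin m, (C (a j) * X 0 + X 1)} : Set (MvPolynomial (Fin 2) ℤ))

noncomputable def z₁ (n m : ℕ) (a : Fin m → ℤ) (b : Fin n → ℤ) : RM n m a b :=
  Ideal.Quotient.mk _ (X 0)

noncomputable def z₂ (n m : ℕ) (a : Fin m → ℤ) (b : Fin n → ℤ) : RM n m a b :=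
  Ideal.Quotient.mk _ (X 1)

/-- An automorphism of `R` is graded iff it preserves the degree-2 part `ℤx₁ ⊕ ℤx₂`. -/
def IsGraded (n m : ℕ) (a : Fin m → ℤ) (b : Fin n → ℤ) (φ : RingAut (RM n m a b)) : Prop :=
  φ (z₁ n m a b) ∈ Submodule.span ℤ ({z₁ n m a b, z₂ n m a b} : Set (RM n m a b)) ∧
  φ (z₂ n m a b) ∈ Submodule.span ℤ ({z₁ n m a b, z₂ n m a b} : Set (RM n m a b))


theorem aux_prod {S : Type*} [CommRing S] (n r : ℕ) (h : r ≤ n) (u v : S) :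
    ∏ i : Fin n, (if (i : ℕ) < r then u else v) = u ^ r * v ^ (n - r) := by
  obtain ⟨k, rfl⟩ := Nat.exists_eq_add_of_le h
  rw [← Finset.prod_range (fun i => if i < r then u else v), Finset.prod_range_add]
  congr 1
  · rw [Finset.prod_congr rfl (g := fun _ => u)]
    · simp
    · intro i hi
      simp [Finset.mem_range.mp hi]
  · simp

/-- small nilpotent power expansion -/
theorem aux_pow {S : Type*} [CommRing S] (a b e : S) (he : e ^ 2 = 0) (k : ℕ) :
    (a + b * e) ^ (k + 1) = a ^ (k + 1) + (k + 1) * a ^ k * b * e := by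
  induction k with
  | zero => simp
  | succ k ih =>
    rw [pow_succ, ih]
    push_cast
    linear_combination ((k : S) + 1) * a ^ k * b ^ 2 * he

theorem aux_dvd_zero (z : ℤ) (h : ∀ t : ℤ, t ≠ 0 → t ∣ z) : z = 0 := by
  by_contra hz
  have h1 := h (2 * z) (by simpa using hz)
  have h2 := Int.le_of_dvd (by positivity : 0 < |z|) ((dvd_abs _ _).mpr h1)
  have h3 : 0 < |z| := by positivity
  have h4 : 2 * |z| ∣ |z| := by
    have := abs_dvd_abs (2 * z) z |>.mpr h1
    simpa [abs_mul] using this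
  have := Int.le_of_dvd h3 h4
  omega

theorem aux_binom (y : ℤ) (A : ℕ) : y ^ 2 ∣ (1 + y) ^ A - (1 + A * y) := by
  induction A with
  | zero => simp
  | succ k ih =>
    obtain ⟨w, hw⟩ := ih
    refine ⟨w * (1 + y) + k, ?_⟩
    rw [pow_succ]
    push_cast
    linear_combination (1 + y) * hw

/-- the bad swap is impossible -/
theorem aux_bad (A B s : ℕ) (hs : 2 ≤ s) (hAB : A ≠ B) (c ε : ℤ) (hε : ε = 1 ∨ ε = -1)
    (h : ℤ → ℤ → ℤ)
    (H : ∀ x y : ℤ, ε * ((x + y) ^ A * x ^ B) =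
      c * (x ^ A * (x + y) ^ B) + h x y * (y ^ s * (2 * x + y) ^ s)) : False := by
  have hε2 : ε * ε = 1 := by rcases hε with rfl | rfl <;> norm_num
  have key : ∀ y : ℤ, y ^ 2 ∣ (1 - ε * c) + (A - ε * c * B) * y := by
    intro y
    obtain ⟨w1, h1⟩ := aux_binom y A
    obtain ⟨w2, h2⟩ := aux_binom y B
    obtain ⟨k, rfl⟩ := Nat.exists_eq_add_of_le hs
    have h3 := H 1 y
    simp only [one_pow, mul_one, one_mul] at h3
    refine ⟨ε * h 1 y * y ^ k * (2 + y) ^ (2 + k) - w1 + ε * c * w2, ?_⟩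
    linear_combination ε * h3 - h1 + ε * c * h2 - ((1 + y) ^ A) * hε2
  have k1 : 1 - ε * c = 0 := by
    apply aux_dvd_zero
    intro t _
    have := (Dvd.intro_left t (by ring : t * t = t ^ 2)).trans (key t)
    exact (dvd_add_left (Dvd.intro_left _ rfl)).mp this
  have k2 : (A : ℤ) - ε * c * B = 0 := by
    apply aux_dvd_zero
    intro t ht
    have := key t
    rw [k1, zero_add, pow_two] at this
    exact Int.dvd_of_mul_dvd_mul_right ht this
  apply hAB
  have : (A : ℤ) = B := by linear_combination k2 - B * k1
  exact_mod_cast this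

/-- if the pencil member is a power product with unequal exponents then `c2 = 0`. -/
theorem aux_pencil (A B s k l : ℕ) (hA : 1 ≤ A) (hB : 1 ≤ B) (hs : 2 ≤ s) (hk : s < k)
    (p q p' q' c1 c2 : ℤ) (hpq : p ≠ 0 ∨ q ≠ 0)
    (H : ∀ (S : Type) [CommRing S] (x y : S),
      (p * x + q * y) ^ k * (p' * x + q' * y) ^ l =
      c1 * (x ^ A * (x + y) ^ B) + c2 * (y ^ s * (2 * x + y) ^ s)) : c2 = 0 := by
  by_contra hc2
  have HZ := H ℤ
  simp only [Int.cast_id] at HZ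
  obtain ⟨x0, hx0⟩ : ∃ x0, x0 = q := ⟨_, rfl⟩
  obtain ⟨u0, hu0⟩ : ∃ u0, u0 = q - p := ⟨_, rfl⟩
  have hk0 : k ≠ 0 := by omega
  have hs0 : s ≠ 0 := by omega
  have hp0 : c1 * (x0 ^ A * u0 ^ B) + c2 * (u0 ^ 2 - x0 ^ 2) ^ s = 0 := by
    have := HZ q (-p)
    rw [show p * q + q * -p = 0 by ring, zero_pow hk0, zero_mul, ← mul_pow] at this
    subst hx0 hu0
    rw [this]
    ring
  have hAp : (1 : ℤ) ≤ A := by exact_mod_cast hA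
  have hBp : (1 : ℤ) ≤ B := by exact_mod_cast hB
  have hsp : (2 : ℤ) ≤ s := by exact_mod_cast hs
  have hpos : 0 < (B : ℤ) * x0 ^ 2 + A * u0 ^ 2 := by
    rcases eq_or_ne x0 0 with h | h
    · have : u0 ≠ 0 := by
        rintro h'
        rcases hpq with h1 | h1 <;> omega
      positivity
    · positivity
  have hux : u0 ^ 2 - x0 ^ 2 = 0 := by
    have hD := H (DualNumber ℤ) ((x0 : DualNumber ℤ) * (1 + (B : DualNumber ℤ) * DualNumber.eps))
      ((u0 : DualNumber ℤ) * (1 + -(A : DualNumber ℤ) * DualNumber.eps) -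
        (x0 : DualNumber ℤ) * (1 + (B : DualNumber ℤ) * DualNumber.eps))
    have he : (DualNumber.eps : DualNumber ℤ) ^ 2 = 0 := by
      rw [pow_two]; exact DualNumber.eps_mul_eps
    set e : DualNumber ℤ := DualNumber.eps with hedef
    obtain ⟨A', rfl⟩ := Nat.exists_eq_add_of_le' hA
    obtain ⟨B', rfl⟩ := Nat.exists_eq_add_of_le' hB
    obtain ⟨s', rfl⟩ := Nat.exists_eq_add_of_le' (show 1 ≤ s by omega)
    obtain ⟨k', rfl⟩ := Nat.exists_eq_add_of_le' (show 2 ≤ k by omega)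
    have hp0' := congrArg (fun z : ℤ => (z : DualNumber ℤ)) hp0
    simp only [Int.cast_add, Int.cast_mul, Int.cast_pow, Int.cast_sub, Int.cast_zero] at hp0'
    have e1 := aux_pow (1 : DualNumber ℤ) ((B' + 1 : ℕ) : DualNumber ℤ) e he A'
    have e2 := aux_pow (1 : DualNumber ℤ) (-((A' + 1 : ℕ) : DualNumber ℤ)) e he B'
    have eP : ((x0 : DualNumber ℤ) * (1 + ((B' + 1 : ℕ) : DualNumber ℤ) * e)) ^ (A' + 1) *
        ((u0 : DualNumber ℤ) * (1 + -((A' + 1 : ℕ) : DualNumber ℤ) * e)) ^ (B' + 1)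
        = (x0 : DualNumber ℤ) ^ (A' + 1) * u0 ^ (B' + 1) := by
      rw [mul_pow, mul_pow, e1, e2]
      push_cast
      simp only [one_pow]
      linear_combination (-(x0 : DualNumber ℤ) ^ (A' + 1) * u0 ^ (B' + 1) *
        ((A' + 1) * (B' + 1)) ^ 2) * he
    have e3 := aux_pow ((u0 : DualNumber ℤ) ^ 2 - x0 ^ 2)
      (-2 * ((B' + 1 : ℕ) * (x0 : DualNumber ℤ) ^ 2 + (A' + 1 : ℕ) * u0 ^ 2)) e he s'
    have eL : (p * ((x0 : DualNumber ℤ) * (1 + ((B' + 1 : ℕ) : DualNumber ℤ) * e)) +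
       q * ((u0 : DualNumber ℤ) * (1 + (-((A' + 1 : ℕ) : DualNumber ℤ)) * e)
         - (x0 : DualNumber ℤ) * (1 + ((B' + 1 : ℕ) : DualNumber ℤ) * e))) ^ (k' + 2) = 0 := by
      have : ∀ w : DualNumber ℤ, (w * e) ^ (k' + 2) = 0 := by
        intro w
        rw [mul_pow, pow_add e, he]; simp
      push_cast
      rw [← this (p * q * (B' + 1) + q * ((q - p) * (-(A' + 1)) - q * (B' + 1))), hx0, hu0]
      congr 1
      push_cast
      ring
    rw [eL, zero_mul, ← mul_pow, add_sub_cancel, eP] at hD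
    have eQ : (((u0 : DualNumber ℤ) * (1 + -((A' + 1 : ℕ) : DualNumber ℤ) * e) -
        (x0 : DualNumber ℤ) * (1 + ((B' + 1 : ℕ) : DualNumber ℤ) * e)) *
        (2 * ((x0 : DualNumber ℤ) * (1 + ((B' + 1 : ℕ) : DualNumber ℤ) * e)) +
        ((u0 : DualNumber ℤ) * (1 + -((A' + 1 : ℕ) : DualNumber ℤ) * e) -
        (x0 : DualNumber ℤ) * (1 + ((B' + 1 : ℕ) : DualNumber ℤ) * e)))) =
        ((u0 : DualNumber ℤ) ^ 2 - x0 ^ 2) +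
        (-2 * ((B' + 1 : ℕ) * (x0 : DualNumber ℤ) ^ 2 + (A' + 1 : ℕ) * u0 ^ 2)) * e := by
      linear_combination ((u0 : DualNumber ℤ) ^ 2 * ((A' + 1 : ℕ) : DualNumber ℤ) ^ 2
        - (x0 : DualNumber ℤ) ^ 2 * ((B' + 1 : ℕ) : DualNumber ℤ) ^ 2) * he
    rw [eQ, e3] at hD
    have hfin : ((c2 * ((s' + 1) * (u0 ^ 2 - x0 ^ 2) ^ s' *
        (-2 * ((B' + 1 : ℕ) * x0 ^ 2 + (A' + 1 : ℕ) * u0 ^ 2))) : ℤ) : DualNumber ℤ) * e = 0 := by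
      push_cast
      push_cast at hD
      linear_combination -hD - hp0'
    have hz := congrArg TrivSqZeroExt.snd hfin
    rw [← zsmul_eq_mul, TrivSqZeroExt.snd_smul, hedef, DualNumber.snd_eps] at hz
    simp only [smul_eq_mul, mul_one, TrivSqZeroExt.snd_zero] at hz
    rcases mul_eq_zero.mp hz with h | h
    · exact absurd h hc2
    rcases mul_eq_zero.mp h with h | h
    · rcases mul_eq_zero.mp h with h | h
      · omega
      · exact pow_eq_zero_iff (by omega) |>.mp h
    · omega
  have hu0n : u0 ≠ 0 := by
    rintro rfl
    have : x0 = 0 := by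
      apply pow_eq_zero_iff (two_ne_zero) |>.mp
      linarith
    rw [this] at hpos
    simp at hpos
  have hx0n : x0 ≠ 0 := by
    intro h
    rw [h] at hux
    exact hu0n (by simpa using hux)
  have hc1 : c1 = 0 := by
    rw [hux, zero_pow hs0, mul_zero, add_zero] at hp0
    rcases mul_eq_zero.mp hp0 with h | h
    · exact h
    · exact absurd h (by positivity)
  have : c2 * (2 * u0) ^ s = 0 := by
    apply aux_dvd_zero
    intro t ht
    have h1 := HZ x0 (u0 + t - x0)
    rw [hc1, zero_mul, zero_add, ← mul_pow,
      show (u0 + t - x0) * (2 * x0 + (u0 + t - x0)) = t * (2 * u0 + t) by linear_combination hux,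
      show p * x0 + q * (u0 + t - x0) = t * q by subst hx0 hu0; ring, mul_pow, mul_pow] at h1
    obtain ⟨j, rfl⟩ := Nat.exists_eq_add_of_lt hk
    have h2 : t ^ s * (t * (t ^ j * q ^ (s + j + 1) *  (p' * x0 + q' * (u0 + t - x0)) ^ l)) =
        t ^ s * (c2 * (2 * u0 + t) ^ s) := by
      linear_combination h1
    have h3 := mul_left_cancel₀ (pow_ne_zero s ht) h2
    have h4 : t ∣ c2 * (2 * u0 + t) ^ s := ⟨_, h3.symm⟩
    have h5 : t ∣ (2 * u0 + t) ^ s - (2 * u0) ^ s := by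
      have := sub_dvd_pow_sub_pow (2 * u0 + t) (2 * u0) s
      simpa using this
    have h6 := dvd_sub h4 (h5.mul_left c2)
    have h7 : c2 * (2 * u0 + t) ^ s - c2 * ((2 * u0 + t) ^ s - (2 * u0) ^ s) = c2 * (2 * u0) ^ s := by
      ring
    rwa [h7] at h6
  rcases mul_eq_zero.mp this with h | h
  · exact hc2 h
  · exact absurd h (by positivity)

theorem aux_unit_prod {a b : ℤ} (h : a * b = 1 ∨ a * b = -1) :
    (a = 1 ∨ a = -1) ∧ (b = 1 ∨ b = -1) := by
  rcases h with h | h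
  · rcases Int.mul_eq_one_iff_eq_one_or_neg_one.mp h with h | h <;> simp [h]
  · rcases Int.mul_eq_neg_one_iff_eq_one_or_neg_one.mp h with h | h <;> simp [h]

/-- target description of the group, by entries -/
def AuxGood (α β γ δ : ℤ) : Prop :=
  (α = 1 ∨ α = -1) ∧ β = 0 ∧ ((γ = 0 ∧ δ = α) ∨ (γ = -2 * α ∧ δ = -α))

theorem aux_bad_pow (A B : ℕ) (u v : ℤ) (hu : u = 1 ∨ u = -1) (hv : v = 1 ∨ v = -1) :
    u ^ A * v ^ B = 1 ∨ u ^ A * v ^ B = -1 := by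
  have h1 : u ^ A = 1 ∨ u ^ A = -1 := by
    rcases hu with rfl | rfl
    · simp
    · exact neg_one_pow_eq_or ℤ A
  have h2 : v ^ B = 1 ∨ v ^ B = -1 := by
    rcases hv with rfl | rfl
    · simp
    · exact neg_one_pow_eq_or ℤ B
  rcases h1 with h1 | h1 <;> rcases h2 with h2 | h2 <;> simp [h1, h2]

/-- the common end of both cases -/
theorem aux_bad' (A B s : ℕ) (hs : 2 ≤ s) (hAB : A ≠ B) (α β γ δ c : ℤ) (h : ℤ → ℤ → ℤ)
    (hα : α = 1 ∨ α = -1) (hγ : α + γ = 1 ∨ α + γ = -1) (h1 : β = α) (h2 : β + δ = 0)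
    (H : ∀ x y : ℤ, (α * x + β * y) ^ A * ((α + γ) * x + (β + δ) * y) ^ B =
      c * (x ^ A * (x + y) ^ B) + h x y * (y ^ s * (2 * x + y) ^ s)) : False := by
  apply aux_bad A B s hs hAB c (α ^ A * (α + γ) ^ B) (aux_bad_pow A B _ _ hα hγ) h
  intro x y
  rw [← H x y, h2, h1, ← mul_add, mul_pow, zero_mul, add_zero, mul_pow]
  ring

theorem aux_case1 (A B s : ℕ) (hA : 1 ≤ A) (hB : 1 ≤ B) (hs : 2 ≤ s) (hAB : A ≠ B)
    (α β γ δ c : ℤ) (hdet : α * δ - β * γ = 1 ∨ α * δ - β * γ = -1)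
    (H : ∀ x y : ℤ, (α * x + β * y) ^ A * ((α + γ) * x + (β + δ) * y) ^ B =
      c * (x ^ A * (x + y) ^ B)) : AuxGood α β γ δ := by
  have hA0 : A ≠ 0 := by omega
  have hB0 : B ≠ 0 := by omega
  have e1 := H 0 1
  have e2 := H 1 (-1)
  simp [hA0, hB0] at e1 e2
  rcases e1 with e1 | e1 <;> rcases e2 with e2 | e2
  · exfalso
    have : α = 0 := by omega
    subst this e1
    simp at hdet
  · have hδ : δ = α + γ := by omega
    subst e1
    have hd : α * (α + γ) = 1 ∨ α * (α + γ) = -1 := by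
      rw [hδ] at hdet; simpa using hdet
    obtain ⟨h1, h2⟩ := aux_unit_prod hd
    refine ⟨h1, rfl, ?_⟩
    omega
  · exfalso
    have hδ : δ = - β := by omega
    have hα : β = α := by omega
    have hd : α * (α + γ) = 1 ∨ α * (α + γ) = -1 := by
      rw [hδ, hα] at hdet
      rcases hdet with h | h
      · right; linarith
      · left; linarith
    obtain ⟨h1, h2⟩ := aux_unit_prod hd
    refine aux_bad' A B s hs hAB α β γ δ c (fun _ _ => 0) h1 h2 hα e1 ?_
    intro x y
    rw [H x y]; ring
  · exfalso
    have h1 : γ = - α := by omega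
    have h2 : δ = - β := by omega
    subst h1 h2
    rcases hdet with h | h <;> ring_nf at h <;> omega

theorem aux_case2 (A B s : ℕ) (hs : 2 ≤ s) (hAB : A ≠ B)
    (α β γ δ c c' : ℤ) (h : ℤ → ℤ → ℤ) (hdet : α * δ - β * γ = 1 ∨ α * δ - β * γ = -1)
    (H : ∀ x y : ℤ, (α * x + β * y) ^ A * ((α + γ) * x + (β + δ) * y) ^ B =
      c * (x ^ A * (x + y) ^ B) + h x y * (y ^ s * (2 * x + y) ^ s))
    (H' : ∀ x y : ℤ, (γ * x + δ * y) ^ s * ((2 * α + γ) * x + (2 * β + δ) * y) ^ s =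
      c' * (y ^ s * (2 * x + y) ^ s)) : AuxGood α β γ δ := by
  have hs0 : s ≠ 0 := by omega
  have e1 := H' 1 0
  have e2 := H' 1 (-2)
  simp [hs0] at e1 e2
  rcases e1 with e1 | e1 <;> rcases e2 with e2 | e2
  · exfalso
    have : δ = 0 := by omega
    subst this e1
    simp at hdet
  · subst e1
    have hd : α * δ = 1 ∨ α * δ = -1 := by simpa using hdet
    obtain ⟨h1, h2⟩ := aux_unit_prod hd
    by_cases hb : β = 0
    · refine ⟨h1, hb, ?_⟩
      omega
    · exfalso
      exact aux_bad' A B s hs hAB α β 0 δ c h h1 (by omega) (by omega) (by omega) H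
  · have hγ : γ = -2 * α := by omega
    have hδ : δ = -α := by omega
    have hd : α * (2 * β - α) = 1 ∨ α * (2 * β - α) = -1 := by
      rw [hγ, hδ] at hdet
      rcases hdet with h | h
      · left; linarith
      · right; linarith
    obtain ⟨h1, h2⟩ := aux_unit_prod hd
    by_cases hb : β = 0
    · refine ⟨h1, hb, ?_⟩
      omega
    · exfalso
      exact aux_bad' A B s hs hAB α β γ δ c h h1 (by omega) (by omega) (by omega) H
  · exfalso
    have h1 : γ = - (2 * α) := by omega
    have h2 : δ = - (2 * β) := by omega
    subst h1 h2
    rcases hdet with h | h <;> ring_nf at h <;> omega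

theorem aux_comp_mul {d p : ℕ} (f P : MvPolynomial (Fin 2) ℤ) (hP : P.IsHomogeneous p) :
    homogeneousComponent d (f * P) =
      if p ≤ d then homogeneousComponent (d - p) f * P else 0 := by
  letI : GradedAlgebra (homogeneousSubmodule (Fin 2) ℤ) := MvPolynomial.gradedAlgebra
  have := DirectSum.coe_decompose_mul_of_right_mem (homogeneousSubmodule (Fin 2) ℤ) d
    (a := f) (b := P) (i := p) hP
  have hd : ∀ (f : MvPolynomial (Fin 2) ℤ) (i : ℕ),
      (DirectSum.decompose (homogeneousSubmodule (Fin 2) ℤ) f i : MvPolynomial (Fin 2) ℤ) =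
      homogeneousComponent i f := fun f i => decomposition.decompose'_apply f i
  rw [hd, hd] at this
  exact this

/-- degree-`d` part of an ideal generated by two homogeneous elements -/
theorem aux_hom_mem {d p q : ℕ} (F P Q : MvPolynomial (Fin 2) ℤ) (hF : F.IsHomogeneous d)
    (hP : P.IsHomogeneous p) (hQ : Q.IsHomogeneous q) (h : F ∈ Ideal.span {P, Q}) :
    ∃ f g : MvPolynomial (Fin 2) ℤ, F = f * P + g * Q ∧
      (d < p → f = 0) ∧ (d < q → g = 0) ∧ (d = p → ∃ c, f = C c) ∧ (d = q → ∃ c, g = C c) := by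
  obtain ⟨f, g, hfg⟩ := Ideal.mem_span_pair.mp h
  have h1 := congrArg (homogeneousComponent d) hfg
  rw [map_add, aux_comp_mul f P hP, aux_comp_mul g Q hQ, homogeneousComponent_eq_self hF] at h1
  refine ⟨if p ≤ d then homogeneousComponent (d - p) f else 0,
    if q ≤ d then homogeneousComponent (d - q) g else 0, ?_, ?_, ?_, ?_, ?_⟩
  · rw [← h1]; split_ifs <;> simp
  · intro h; rw [if_neg (by omega)]
  · intro h; rw [if_neg (by omega)]
  · rintro rfl; exact ⟨coeff 0 f, by simp [homogeneousComponent_zero]⟩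
  · rintro rfl; exact ⟨coeff 0 g, by simp [homogeneousComponent_zero]⟩

/-- a linear form -/
noncomputable def auxL (p q : ℤ) : MvPolynomial (Fin 2) ℤ := C p * X 0 + C q * X 1

theorem auxL_hom (p q : ℤ) : (auxL p q).IsHomogeneous 1 :=
  (isHomogeneous_C_mul_X _ _).add (isHomogeneous_C_mul_X _ _)

theorem auxLL_hom (p q p' q' : ℤ) (k l : ℕ) :
    (auxL p q ^ k * auxL p' q' ^ l).IsHomogeneous (k + l) := by
  have := ((auxL_hom p q).pow k).mul ((auxL_hom p' q').pow l)
  simpa using this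

theorem aux_PQ (n m r s : ℕ) (hrn : r ≤ n) (hsm : s ≤ m)
    (hs : 2 * s = m + 1) (a : Fin m → ℤ) (b : Fin n → ℤ)
    (ha : ∀ j : Fin m, a j = if (j : ℕ) < s then 2 else 0)
    (hb : ∀ i : Fin n, b i = if (i : ℕ) < r then 1 else 0) :
    (X 0 * ∏ i : Fin n, (X 0 + C (b i) * X 1) : MvPolynomial (Fin 2) ℤ)
      = auxL 1 0 ^ (n + 1 - r) * auxL 1 1 ^ r ∧
    (X 1 * ∏ j : Fin m, (C (a j) * X 0 + X 1) : MvPolynomial (Fin 2) ℤ)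
      = auxL 0 1 ^ s * auxL 2 1 ^ s := by
  constructor
  · have : ∀ i : Fin n, (X 0 + C (b i) * X 1 : MvPolynomial (Fin 2) ℤ) =
        if (i : ℕ) < r then auxL 1 1 else auxL 1 0 := by
      intro i
      rw [hb]
      split_ifs <;> simp [auxL]
    rw [Finset.prod_congr rfl (fun i _ => this i), aux_prod n r hrn]
    rw [show n + 1 - r = (n - r) + 1 by omega, pow_succ]
    have : (X 0 : MvPolynomial (Fin 2) ℤ) = auxL 1 0 := by simp [auxL]
    rw [this]; ring
  · have : ∀ i : Fin m, (C (a i) * X 0 + X 1 : MvPolynomial (Fin 2) ℤ) =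
        if (i : ℕ) < s then auxL 2 1 else auxL 0 1 := by
      intro i
      rw [ha]
      split_ifs <;> simp [auxL]
    rw [Finset.prod_congr rfl (fun i _ => this i), aux_prod m s hsm]
    obtain ⟨k, rfl⟩ := Nat.exists_eq_add_of_le' (show 1 ≤ s by omega)
    rw [show m - (k + 1) = k by omega]
    have : (X 1 : MvPolynomial (Fin 2) ℤ) = auxL 0 1 := by simp [auxL]
    rw [this]; ring

/-- substitution by a matrix -/
noncomputable def auxSub (α β γ δ : ℤ) : MvPolynomial (Fin 2) ℤ →+* MvPolynomial (Fin 2) ℤ :=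
  (aeval (R := ℤ) ![auxL α β, auxL γ δ]).toRingHom

theorem auxSub_L (α β γ δ p q : ℤ) :
    auxSub α β γ δ (auxL p q) = auxL (p * α + q * γ) (p * β + q * δ) := by
  simp [auxSub, auxL]
  ring

/-- evaluate in a ring -/
theorem aux_eval_L {S : Type} [CommRing S] (x y : S) (p q : ℤ) :
    aeval (R := ℤ) ![x, y] (auxL p q) = p * x + q * y := by
  simp [auxL]

theorem aux_entries (n r s m : ℕ) (hn : 2 ≤ n) (hm : 2 ≤ m)
    (hr1 : 1 ≤ r) (hrn : r ≤ n) (hs : 2 * s = m + 1) (hr : 2 * r ≠ n + 1)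
    (α β γ δ : ℤ) (hdet : α * δ - β * γ = 1 ∨ α * δ - β * γ = -1)
    (HP : auxSub α β γ δ (auxL 1 0 ^ (n + 1 - r) * auxL 1 1 ^ r) ∈
      Ideal.span {auxL 1 0 ^ (n + 1 - r) * auxL 1 1 ^ r, auxL 0 1 ^ s * auxL 2 1 ^ s})
    (HQ : auxSub α β γ δ (auxL 0 1 ^ s * auxL 2 1 ^ s) ∈
      Ideal.span {auxL 1 0 ^ (n + 1 - r) * auxL 1 1 ^ r, auxL 0 1 ^ s * auxL 2 1 ^ s}) :
    AuxGood α β γ δ := by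
  obtain ⟨A, hA⟩ : ∃ A, A = n + 1 - r := ⟨_, rfl⟩
  rw [← hA] at HP HQ
  have hs2 : 2 ≤ s := by omega
  have hAB : A ≠ r := by omega
  simp only [map_mul, map_pow, auxSub_L, one_mul, zero_mul, add_zero, zero_add] at HP HQ
  obtain ⟨f, g, e, c1, c2, c3, c4⟩ := aux_hom_mem _ _ _ (auxLL_hom _ _ _ _ _ _)
    (auxLL_hom _ _ _ _ _ _) (auxLL_hom _ _ _ _ _ _) HP
  obtain ⟨f', g', e', c1', c2', c3', c4'⟩ := aux_hom_mem _ _ _ (auxLL_hom _ _ _ _ _ _)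
    (auxLL_hom _ _ _ _ _ _) (auxLL_hom _ _ _ _ _ _) HQ
  obtain ⟨c, rfl⟩ := c3 rfl
  obtain ⟨c', rfl⟩ := c4' rfl
  have E : ∀ (S : Type) [CommRing S] (x y : S),
      (α * x + β * y) ^ A * ((α + γ : ℤ) * x + (β + δ : ℤ) * y) ^ r =
      c * (x ^ A * (x + y) ^ r) + (aeval (R := ℤ) ![x, y] g) * (y ^ s * (2 * x + y) ^ s) := by
    intro S _ x y
    have := congrArg (aeval (R := ℤ) ![x, y]) e
    simpa [aux_eval_L] using this
  have EZ : ∀ (x y : ℤ),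
      (α * x + β * y) ^ A * ((α + γ) * x + (β + δ) * y) ^ r =
      c * (x ^ A * (x + y) ^ r) + (aeval (R := ℤ) ![x, y] g) * (y ^ s * (2 * x + y) ^ s) := by
    intro x y
    simpa using E ℤ x y
  rcases lt_trichotomy n m with hnm | hnm | hnm
  · have hg := c2 (by omega)
    subst hg
    apply aux_case1 A r s (by omega) hr1 hs2 hAB α β γ δ c hdet
    intro x y
    rw [EZ x y]; simp
  · obtain ⟨d, rfl⟩ := c4 (by omega)
    have hd : d = 0 := by
      rcases lt_or_gt_of_ne hAB with hlt | hlt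
      · refine aux_pencil A r s r A (by omega) hr1 hs2 (by omega) (α + γ) (β + δ) α β c d ?_ ?_
        · by_contra! h
          have h1 : γ = - α := by omega
          have h2 : δ = - β := by omega
          subst h1 h2
          rcases hdet with h | h <;> ring_nf at h <;> omega
        · intro S _ x y
          have := E S x y
          rw [mul_comm, this]
          simp
      · refine aux_pencil A r s A r (by omega) hr1 hs2 (by omega) α β (α + γ) (β + δ) c d ?_ ?_
        · by_contra! h
          rw [h.1, h.2] at hdet
          simp at hdet
        · intro S _ x y
          have := E S x y
          rw [this]
          simp
    subst hd
    apply aux_case1 A r s (by omega) hr1 hs2 hAB α β γ δ c hdet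
    intro x y
    rw [EZ x y]; simp
  · have hf := c1' (by omega)
    subst hf
    apply aux_case2 A r s hs2 hAB α β γ δ c c' (fun x y => aeval (R := ℤ) ![x, y] g) hdet EZ
    intro x y
    have := congrArg (aeval (R := ℤ) ![x, y]) e'
    simp only [map_mul, map_pow, map_add, aux_eval_L] at this
    simpa using this

/-- the first-order hom -/
theorem aux_rho (I : Ideal (MvPolynomial (Fin 2) ℤ)) (A B s : ℕ) (hA : 1 ≤ A) (hB : 1 ≤ B)
    (hs : 2 ≤ s)
    (hI : I = Ideal.span {auxL 1 0 ^ A * auxL 1 1 ^ B, auxL 0 1 ^ s * auxL 2 1 ^ s}) :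
    ∃ ρ : (MvPolynomial (Fin 2) ℤ ⧸ I) →+* TrivSqZeroExt ℤ (ℤ × ℤ),
      ρ (Ideal.Quotient.mk I (X 0)) = TrivSqZeroExt.inr (1, 0) ∧
      ρ (Ideal.Quotient.mk I (X 1)) = TrivSqZeroExt.inr (0, 1) := by
  set ev : MvPolynomial (Fin 2) ℤ →+* TrivSqZeroExt ℤ (ℤ × ℤ) :=
    (aeval (R := ℤ) ![TrivSqZeroExt.inr (1, 0), TrivSqZeroExt.inr (0, 1)]).toRingHom with hev
  have hL : ∀ p q, ev (auxL p q) = TrivSqZeroExt.inr (p, q) := by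
    intro p q
    have : ev (auxL p q) = _ := aux_eval_L _ _ p q
    rw [this, ← zsmul_eq_mul, ← zsmul_eq_mul, ← TrivSqZeroExt.inr_smul, ← TrivSqZeroExt.inr_smul,
      ← TrivSqZeroExt.inr_add]
    simp
  have h0 : ∀ a ∈ I, ev a = 0 := by
    intro a ha
    have : I ≤ RingHom.ker ev := by
      rw [hI, Ideal.span_le]
      rintro f (rfl | rfl)
      · obtain ⟨A', rfl⟩ := Nat.exists_eq_add_of_le' hA
        obtain ⟨B', rfl⟩ := Nat.exists_eq_add_of_le' hB
        simp only [SetLike.mem_coe, RingHom.mem_ker, map_mul, map_pow, hL, pow_succ]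
        rw [mul_mul_mul_comm, TrivSqZeroExt.inr_mul_inr, mul_zero]
      · obtain ⟨s', rfl⟩ := Nat.exists_eq_add_of_le' hs
        simp only [SetLike.mem_coe, RingHom.mem_ker, map_mul, map_pow, hL, pow_succ]
        rw [mul_assoc _ (TrivSqZeroExt.inr _) (TrivSqZeroExt.inr _),
          TrivSqZeroExt.inr_mul_inr, mul_zero, zero_mul]
    exact this ha
  refine ⟨Ideal.Quotient.lift I ev h0, ?_, ?_⟩
  · rw [Ideal.Quotient.lift_mk]; simp [hev]
  · rw [Ideal.Quotient.lift_mk]; simp [hev]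

theorem aux_ext {I : Ideal (MvPolynomial (Fin 2) ℤ)} {S : Type*} [CommRing S]
    (f g : (MvPolynomial (Fin 2) ℤ ⧸ I) →+* S)
    (h0 : f (Ideal.Quotient.mk I (X 0)) = g (Ideal.Quotient.mk I (X 0)))
    (h1 : f (Ideal.Quotient.mk I (X 1)) = g (Ideal.Quotient.mk I (X 1))) : f = g := by
  apply Ideal.Quotient.ringHom_ext
  apply MvPolynomial.ringHom_ext
  · intro r; simp
  · intro i
    fin_cases i
    · exact h0
    · exact h1

theorem aux_det (I : Ideal (MvPolynomial (Fin 2) ℤ))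
    (ρ : (MvPolynomial (Fin 2) ℤ ⧸ I) →+* TrivSqZeroExt ℤ (ℤ × ℤ))
    (h0 : ρ (Ideal.Quotient.mk I (X 0)) = TrivSqZeroExt.inr (1, 0))
    (h1 : ρ (Ideal.Quotient.mk I (X 1)) = TrivSqZeroExt.inr (0, 1))
    (φ : RingAut (MvPolynomial (Fin 2) ℤ ⧸ I)) (α β γ δ : ℤ)
    (e0 : φ (Ideal.Quotient.mk I (X 0)) =
      α • Ideal.Quotient.mk I (X 0) + β • Ideal.Quotient.mk I (X 1))
    (e1 : φ (Ideal.Quotient.mk I (X 1)) =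
      γ • Ideal.Quotient.mk I (X 0) + δ • Ideal.Quotient.mk I (X 1)) :
    α * δ - β * γ = 1 ∨ α * δ - β * γ = -1 := by
  let T : (ℤ × ℤ) →ₗ[ℤ] (ℤ × ℤ) :=
    (LinearMap.fst ℤ ℤ ℤ).smulRight (α, β) + (LinearMap.snd ℤ ℤ ℤ).smulRight (γ, δ)
  have key : (TrivSqZeroExt.map T).toRingHom.comp ρ = ρ.comp φ.toRingHom := by
    apply aux_ext
    · change TrivSqZeroExt.map T (ρ _) = ρ (φ _)
      rw [e0, map_add, map_zsmul, map_zsmul, h0, h1, TrivSqZeroExt.map_inr,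
        ← TrivSqZeroExt.inr_smul, ← TrivSqZeroExt.inr_smul, ← TrivSqZeroExt.inr_add]
      simp [T]
    · change TrivSqZeroExt.map T (ρ _) = ρ (φ _)
      rw [e1, map_add, map_zsmul, map_zsmul, h0, h1, TrivSqZeroExt.map_inr,
        ← TrivSqZeroExt.inr_smul, ← TrivSqZeroExt.inr_smul, ← TrivSqZeroExt.inr_add]
      simp [T]
  have key2 : ∀ z, T (ρ (φ.symm z)).snd = (ρ z).snd := by
    intro z
    have := congrArg TrivSqZeroExt.snd (RingHom.congr_fun key (φ.symm z))
    change (TrivSqZeroExt.map T (ρ (φ.symm z))).snd = (ρ (φ (φ.symm z))).snd at this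
    rw [TrivSqZeroExt.snd_map, RingEquiv.apply_symm_apply] at this
    exact this
  have k0 := key2 (Ideal.Quotient.mk I (X 0))
  have k1 := key2 (Ideal.Quotient.mk I (X 1))
  rw [h0] at k0
  rw [h1] at k1
  generalize (ρ (φ.symm (Ideal.Quotient.mk I (X 0)))).snd = v at k0
  generalize (ρ (φ.symm (Ideal.Quotient.mk I (X 1)))).snd = w at k1
  obtain ⟨v0, v1⟩ := v
  obtain ⟨w0, w1⟩ := w
  simp [T] at k0 k1
  obtain ⟨a1, a2⟩ := k0
  obtain ⟨a3, a4⟩ := k1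
  have : (α * δ - β * γ) * (v0 * w1 - v1 * w0) = 1 := by
    linear_combination (w0 * β + w1 * δ) * a1 - (w0 * α + w1 * γ) * a2 + a4
  exact (aux_unit_prod (Or.inl this)).1

/-- lifting of a substitution to the quotient -/
theorem aux_lift (I : Ideal (MvPolynomial (Fin 2) ℤ)) (P Q : MvPolynomial (Fin 2) ℤ)
    (hI : I = Ideal.span {P, Q}) (α β γ δ : ℤ)
    (hP : auxSub α β γ δ P ∈ I) (hQ : auxSub α β γ δ Q ∈ I)
    (q1 : α * α + β * γ = 1) (q2 : α * β + β * δ = 0) (q3 : γ * α + δ * γ = 0)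
    (q4 : γ * β + δ * δ = 1) :
    ∃ φ : RingAut (MvPolynomial (Fin 2) ℤ ⧸ I),
      φ (Ideal.Quotient.mk I (X 0)) =
        α • Ideal.Quotient.mk I (X 0) + β • Ideal.Quotient.mk I (X 1) ∧
      φ (Ideal.Quotient.mk I (X 1)) =
        γ • Ideal.Quotient.mk I (X 0) + δ • Ideal.Quotient.mk I (X 1) := by
  have hle : I ≤ I.comap (auxSub α β γ δ) := by
    conv_lhs => rw [hI]
    rw [Ideal.span_le]
    rintro f (rfl | rfl)
    · exact hP
    · exact hQ
  let ψ := Ideal.quotientMap I (auxSub α β γ δ) hle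
  have hL : ∀ p q : ℤ, Ideal.Quotient.mk I (auxL p q) =
      p • Ideal.Quotient.mk I (X 0) + q • Ideal.Quotient.mk I (X 1) := by
    intro p q
    simp [auxL]
  have f0 : ψ (Ideal.Quotient.mk I (X 0)) =
        α • Ideal.Quotient.mk I (X 0) + β • Ideal.Quotient.mk I (X 1) := by
    rw [← hL]; simp [ψ, auxSub]
  have f1 : ψ (Ideal.Quotient.mk I (X 1)) =
        γ • Ideal.Quotient.mk I (X 0) + δ • Ideal.Quotient.mk I (X 1) := by
    rw [← hL]; simp [ψ, auxSub]
  have hψ : ψ.comp ψ = RingHom.id _ := by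
    apply aux_ext
    · rw [RingHom.comp_apply, f0, map_add, map_zsmul, map_zsmul, f0, f1, RingHom.id_apply]
      simp only [smul_add, smul_smul]
      rw [add_add_add_comm, ← add_smul, ← add_smul, q1, q2]
      simp
    · rw [RingHom.comp_apply, f1, map_add, map_zsmul, map_zsmul, f0, f1, RingHom.id_apply]
      simp only [smul_add, smul_smul]
      rw [add_add_add_comm, ← add_smul, ← add_smul, q3, q4]
      simp
  exact ⟨RingEquiv.ofRingHom ψ ψ hψ hψ, f0, f1⟩

/-- two commuting involutions -/
theorem aux_klein {G : Type*} [Group G] (u v : G) (hu : u * u = 1) (hv : v * v = 1)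
    (huv : u * v = v * u) :
    ∃ e : Multiplicative (ZMod 2 × ZMod 2) →* G,
      ∀ i j : ZMod 2, e (Multiplicative.ofAdd (i, j)) = u ^ i.val * v ^ j.val := by
  have hadd : ∀ (w : G), w * w = 1 → ∀ i j : ZMod 2, w ^ (i + j).val = w ^ i.val * w ^ j.val := by
    intro w hw i j
    rw [ZMod.val_add, ← pow_add, ← pow_mod_orderOf, ← pow_mod_orderOf w (i.val + j.val),
      Nat.mod_mod_of_dvd _ (orderOf_dvd_of_pow_eq_one (by rw [pow_two, hw]))]
  refine ⟨⟨⟨fun p => u ^ p.toAdd.1.val * v ^ p.toAdd.2.val, by simp⟩, ?_⟩, fun i j => rfl⟩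
  intro p q
  have hc : Commute u v := huv
  change u ^ (p.toAdd.1 + q.toAdd.1).val * v ^ (p.toAdd.2 + q.toAdd.2).val = _
  rw [hadd u hu, hadd v hv]
  exact (hc.pow_pow q.toAdd.1.val p.toAdd.2.val).mul_mul_mul_comm _ _

theorem aux_ext' {I : Ideal (MvPolynomial (Fin 2) ℤ)}
    (φ ψ : RingAut (MvPolynomial (Fin 2) ℤ ⧸ I))
    (h0 : φ (Ideal.Quotient.mk I (X 0)) = ψ (Ideal.Quotient.mk I (X 0)))
    (h1 : φ (Ideal.Quotient.mk I (X 1)) = ψ (Ideal.Quotient.mk I (X 1))) : φ = ψ :=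
  RingEquiv.ext fun z => RingHom.congr_fun (aux_ext φ.toRingHom ψ.toRingHom h0 h1) z

theorem auxL_neg (p q : ℤ) : auxL (-p) (-q) = -auxL p q := by
  simp [auxL]; ring

theorem aux_neg_mem (I : Ideal (MvPolynomial (Fin 2) ℤ)) (u v : MvPolynomial (Fin 2) ℤ)
    (A B : ℕ) (h : u ^ A * v ^ B ∈ I) :
    (-u) ^ A * (-v) ^ B ∈ I ∧ u ^ A * (-v) ^ B ∈ I := by
  rw [neg_pow u, neg_pow v]
  constructor
  · rw [mul_mul_mul_comm]; exact I.mul_mem_left _ h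
  · rw [mul_left_comm]; exact I.mul_mem_left _ h

theorem aux_mem_span (n m : ℕ) (a : Fin m → ℤ) (b : Fin n → ℤ) (w : RM n m a b) :
    w ∈ Submodule.span ℤ ({z₁ n m a b, z₂ n m a b} : Set (RM n m a b)) ↔
    ∃ p q : ℤ, p • z₁ n m a b + q • z₂ n m a b = w := Submodule.mem_span_pair

/-- everything except for the matrix bookkeeping, for the abstract ideal -/
theorem aux_main_gen (n m r s : ℕ) (hn : 2 ≤ n) (hm : 2 ≤ m)
    (hr1 : 1 ≤ r) (hrn : r ≤ n)
    (hs : 2 * s = m + 1) (hr : 2 * r ≠ n + 1) (I : Ideal (MvPolynomial (Fin 2) ℤ))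
    (hI : I = Ideal.span
      {auxL 1 0 ^ (n + 1 - r) * auxL 1 1 ^ r, auxL 0 1 ^ s * auxL 2 1 ^ s})
    (x y : MvPolynomial (Fin 2) ℤ ⧸ I) (hx : x = Ideal.Quotient.mk I (X 0))
    (hy : y = Ideal.Quotient.mk I (X 1)) :
    (∀ (φ : RingAut (MvPolynomial (Fin 2) ℤ ⧸ I)) (α β γ δ : ℤ),
        φ x = α • x + β • y → φ y = γ • x + δ • y → AuxGood α β γ δ) ∧
    (∀ α β γ δ : ℤ, AuxGood α β γ δ → ∃ φ : RingAut (MvPolynomial (Fin 2) ℤ ⧸ I),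
        φ x = α • x + β • y ∧ φ y = γ • x + δ • y) ∧
    (∀ φ ψ : RingAut (MvPolynomial (Fin 2) ℤ ⧸ I), φ x = ψ x → φ y = ψ y → φ = ψ) ∧
    (∀ p q p' q' : ℤ, p • x + q • y = p' • x + q' • y → p = p' ∧ q = q') := by
  subst hx hy
  have mP : auxL 1 0 ^ (n + 1 - r) * auxL 1 1 ^ r ∈ I := by
    rw [hI]; exact Ideal.subset_span (by simp)
  have mQ : auxL 0 1 ^ s * auxL 2 1 ^ s ∈ I := by
    rw [hI]; exact Ideal.subset_span (by simp)
  obtain ⟨ρ, ρ0, ρ1⟩ := aux_rho I (n + 1 - r) r s (by omega) hr1 (by omega) hI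
  refine ⟨?_, ?_, fun φ ψ => aux_ext' φ ψ, ?_⟩
  · intro φ α β γ δ e0 e1
    have hdet := aux_det I ρ ρ0 ρ1 φ α β γ δ e0 e1
    have hφ : φ.toRingHom.comp (Ideal.Quotient.mk I) =
        (Ideal.Quotient.mk I).comp (auxSub α β γ δ) := by
      apply MvPolynomial.ringHom_ext
      · intro k; simp
      · intro i
        fin_cases i
        · change φ (Ideal.Quotient.mk I (X 0)) = _
          rw [e0]; simp [auxSub, auxL]
        · change φ (Ideal.Quotient.mk I (X 1)) = _
          rw [e1]; simp [auxSub, auxL]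
    have hmem : ∀ f ∈ I, auxSub α β γ δ f ∈ I := by
      intro f hf
      rw [← Ideal.Quotient.eq_zero_iff_mem]
      have := RingHom.congr_fun hφ f
      change φ (Ideal.Quotient.mk I f) = Ideal.Quotient.mk I (auxSub α β γ δ f) at this
      rw [← this, Ideal.Quotient.eq_zero_iff_mem.mpr hf, map_zero]
    have HP := hmem _ mP
    have HQ := hmem _ mQ
    rw [hI] at HP HQ
    exact aux_entries n r s m hn hm hr1 hrn hs hr α β γ δ hdet HP HQ
  · intro α β γ δ hg
    have mQ' : auxL 2 1 ^ s * auxL 0 1 ^ s ∈ I := by rw [mul_comm]; exact mQ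
    have nP := aux_neg_mem I _ _ _ _ mP
    have nQ := aux_neg_mem I _ _ _ _ mQ
    have nQ' := aux_neg_mem I _ _ _ _ mQ'
    simp only [← auxL_neg, neg_zero] at nP nQ nQ'
    have hsub : auxSub α β γ δ (auxL 1 0 ^ (n + 1 - r) * auxL 1 1 ^ r) ∈ I ∧
        auxSub α β γ δ (auxL 0 1 ^ s * auxL 2 1 ^ s) ∈ I := by
      simp only [map_mul, map_pow, auxSub_L, one_mul, zero_mul, add_zero, zero_add]
      obtain ⟨h1, h2, h3⟩ := hg
      rcases h1 with rfl | rfl <;> rcases h3 with ⟨rfl, rfl⟩ | ⟨rfl, rfl⟩ <;> subst h2 <;>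
        norm_num
      · exact ⟨mP, mQ⟩
      · exact ⟨nP.2, nQ'.1⟩
      · exact ⟨nP.1, nQ.1⟩
      · refine ⟨?_, mQ'⟩
        have := (aux_neg_mem I _ _ _ _ nP.1).2
        simpa only [← auxL_neg, neg_zero, neg_neg] using this
    refine aux_lift I _ _ hI α β γ δ hsub.1 hsub.2 ?_ ?_ ?_ ?_ <;>
    · obtain ⟨h1, h2, h3⟩ := hg
      rcases h1 with rfl | rfl <;> rcases h3 with ⟨rfl, rfl⟩ | ⟨rfl, rfl⟩ <;> subst h2 <;>
        norm_num
  · intro p q p' q' h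
    have h1 := congrArg (fun z => (ρ z).snd) h
    simp only [map_add, map_zsmul, ρ0, ρ1, TrivSqZeroExt.snd_add, TrivSqZeroExt.snd_smul,
      TrivSqZeroExt.snd_inr] at h1
    simpa using h1

/-- everything except for the matrix bookkeeping -/
theorem aux_main (n m r s : ℕ) (hn : 2 ≤ n) (hm : 2 ≤ m)
    (hr1 : 1 ≤ r) (hrn : r ≤ n) (hsm : s ≤ m)
    (hs : 2 * s = m + 1) (hr : 2 * r ≠ n + 1)
    (a : Fin m → ℤ) (b : Fin n → ℤ)
    (ha : ∀ j : Fin m, a j = if (j : ℕ) < s then 2 else 0)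
    (hb : ∀ i : Fin n, b i = if (i : ℕ) < r then 1 else 0) :
    (∀ (φ : RingAut (RM n m a b)) (α β γ δ : ℤ),
        φ (z₁ n m a b) = α • z₁ n m a b + β • z₂ n m a b →
        φ (z₂ n m a b) = γ • z₁ n m a b + δ • z₂ n m a b → AuxGood α β γ δ) ∧
    (∀ α β γ δ : ℤ, AuxGood α β γ δ → ∃ φ : RingAut (RM n m a b),
        φ (z₁ n m a b) = α • z₁ n m a b + β • z₂ n m a b ∧
        φ (z₂ n m a b) = γ • z₁ n m a b + δ • z₂ n m a b) ∧
    (∀ φ ψ : RingAut (RM n m a b), φ (z₁ n m a b) = ψ (z₁ n m a b) →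
        φ (z₂ n m a b) = ψ (z₂ n m a b) → φ = ψ) ∧
    (∀ p q p' q' : ℤ, p • z₁ n m a b + q • z₂ n m a b = p' • z₁ n m a b + q' • z₂ n m a b →
        p = p' ∧ q = q') := by
  obtain ⟨hP, hQ⟩ := aux_PQ n m r s hrn hsm hs a b ha hb
  exact aux_main_gen n m r s hn hm hr1 hrn hs hr _ (by rw [hP, hQ]) (z₁ n m a b) (z₂ n m a b)
    rfl rfl

theorem aux_good_mem (g : Matrix (Fin 2) (Fin 2) ℤ) :
    g ∈ ({1, -1, !![1, 0; -2, -1], !![-1, 0; 2, 1]} : Set (Matrix (Fin 2) (Fin 2) ℤ)) ↔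
    AuxGood (g 0 0) (g 0 1) (g 1 0) (g 1 1) := by
  simp only [Set.mem_insert_iff, Set.mem_singleton_iff, ← Matrix.ext_iff, Fin.forall_fin_two]
  simp [AuxGood]
  omega

/-- Let `n, m ≥ 2`, `a = (2,…,2,0,…,0)` with `s` twos (`1 ≤ s ≤ m`), and
`b = (1,…,1,0,…,0)` with `r` ones (`1 ≤ r ≤ n`), where `s = (m+1)/2` (so `m` is odd) and
`r ≠ (n+1)/2`.  Then the group of graded ring automorphisms of
`R = ℤ[x₁,x₂]/⟨x₁·∏ᵢ(x₁+bᵢx₂), x₂·∏ⱼ(aⱼx₁+x₂)⟩`, identified with 2×2 integer matrices via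
the action on the degree-2 part, is exactly `{I, -I, (1,0;-2,-1), (-1,0;2,1)} ≅ ℤ/2 × ℤ/2`. -/
theorem stmt7 (n m r s : ℕ) (hn : 2 ≤ n) (hm : 2 ≤ m)
    (hr1 : 1 ≤ r) (hrn : r ≤ n) (hs1 : 1 ≤ s) (hsm : s ≤ m)
    (hs : 2 * s = m + 1) (hr : 2 * r ≠ n + 1)
    (a : Fin m → ℤ) (b : Fin n → ℤ)
    (ha : ∀ j : Fin m, a j = if (j : ℕ) < s then 2 else 0)
    (hb : ∀ i : Fin n, b i = if (i : ℕ) < r then 1 else 0) :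
    (∀ (φ : RingAut (RM n m a b)) (g : Matrix (Fin 2) (Fin 2) ℤ),
        φ (z₁ n m a b) = g 0 0 • z₁ n m a b + g 0 1 • z₂ n m a b →
        φ (z₂ n m a b) = g 1 0 • z₁ n m a b + g 1 1 • z₂ n m a b →
        g ∈ ({1, -1, !![1, 0; -2, -1], !![-1, 0; 2, 1]} : Set (Matrix (Fin 2) (Fin 2) ℤ))) ∧
    (∀ g ∈ ({1, -1, !![1, 0; -2, -1], !![-1, 0; 2, 1]} : Set (Matrix (Fin 2) (Fin 2) ℤ)),
        ∃ φ : RingAut (RM n m a b),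
          φ (z₁ n m a b) = g 0 0 • z₁ n m a b + g 0 1 • z₂ n m a b ∧
          φ (z₂ n m a b) = g 1 0 • z₁ n m a b + g 1 1 • z₂ n m a b) ∧
    (∃ e : Multiplicative (ZMod 2 × ZMod 2) →* RingAut (RM n m a b),
        Function.Injective e ∧
        ∀ φ : RingAut (RM n m a b), φ ∈ Set.range e ↔ IsGraded n m a b φ) := by
  obtain ⟨h1, h2, h3, h4⟩ := aux_main n m r s hn hm hr1 hrn hsm hs hr a b ha hb
  refine ⟨fun φ g e0 e1 => (aux_good_mem g).mpr (h1 φ _ _ _ _ e0 e1),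
    fun g hg => h2 _ _ _ _ ((aux_good_mem g).mp hg), ?_⟩
  obtain ⟨u, u0, u1⟩ := h2 (-1) 0 0 (-1) (by simp [AuxGood])
  obtain ⟨v, v0, v1⟩ := h2 1 0 (-2) (-1) (by simp [AuxGood])
  have uv0 : (u * v) (z₁ n m a b) = (-1 : ℤ) • z₁ n m a b + (0 : ℤ) • z₂ n m a b := by
    rw [RingAut.mul_apply, v0, map_add, map_zsmul, map_zsmul, u0, u1]
    module
  have uv1 : (u * v) (z₂ n m a b) = (2 : ℤ) • z₁ n m a b + (1 : ℤ) • z₂ n m a b := by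
    rw [RingAut.mul_apply, v1, map_add, map_zsmul, map_zsmul, u0, u1]
    module
  have one0 : (1 : RingAut (RM n m a b)) (z₁ n m a b) =
      (1 : ℤ) • z₁ n m a b + (0 : ℤ) • z₂ n m a b := by
    rw [RingAut.one_apply]; module
  have one1 : (1 : RingAut (RM n m a b)) (z₂ n m a b) =
      (0 : ℤ) • z₁ n m a b + (1 : ℤ) • z₂ n m a b := by
    rw [RingAut.one_apply]; module
  have huu : u * u = 1 := by
    apply h3
    · rw [RingAut.mul_apply, one0, u0, map_add, map_zsmul, map_zsmul, u0, u1]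
      module
    · rw [RingAut.mul_apply, one1, u1, map_add, map_zsmul, map_zsmul, u0, u1]
      module
  have hvv : v * v = 1 := by
    apply h3
    · rw [RingAut.mul_apply, one0, v0, map_add, map_zsmul, map_zsmul, v0, v1]
      module
    · rw [RingAut.mul_apply, one1, v1, map_add, map_zsmul, map_zsmul, v0, v1]
      module
  have huv : u * v = v * u := by
    apply h3
    · rw [uv0, RingAut.mul_apply, u0, map_add, map_zsmul, map_zsmul, v0, v1]
      module
    · rw [uv1, RingAut.mul_apply, u1, map_add, map_zsmul, map_zsmul, v0, v1]
      module
  obtain ⟨e, he⟩ := aux_klein u v huu hvv huv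
  have val1 : (1 : ZMod 2).val = 1 := rfl
  have e00 : e (Multiplicative.ofAdd (0, 0)) = 1 := by rw [he]; simp
  have e10 : e (Multiplicative.ofAdd (1, 0)) = u := by rw [he]; simp [val1]
  have e01 : e (Multiplicative.ofAdd (0, 1)) = v := by rw [he]; simp [val1]
  have e11 : e (Multiplicative.ofAdd (1, 1)) = u * v := by rw [he]; simp [val1]
  have hcases : ∀ p : Multiplicative (ZMod 2 × ZMod 2), p = Multiplicative.ofAdd (0, 0) ∨
      p = Multiplicative.ofAdd (1, 0) ∨ p = Multiplicative.ofAdd (0, 1) ∨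
      p = Multiplicative.ofAdd (1, 1) := by decide
  refine ⟨e, ?_, ?_⟩
  · rw [injective_iff_map_eq_one]
    intro p hp
    rcases hcases p with rfl | rfl | rfl | rfl
    · rfl
    · exfalso
      rw [e10] at hp
      rw [hp, one0] at u0
      have := h4 _ _ _ _ u0
      omega
    · exfalso
      rw [e01] at hp
      rw [hp, one1] at v1
      have := h4 _ _ _ _ v1
      omega
    · exfalso
      rw [e11] at hp
      rw [hp, one0] at uv0
      have := h4 _ _ _ _ uv0
      omega
  · intro φ
    unfold IsGraded
    rw [aux_mem_span, aux_mem_span]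
    constructor
    · rintro ⟨p, rfl⟩
      rcases hcases p with rfl | rfl | rfl | rfl
      · rw [e00]; exact ⟨⟨_, _, one0.symm⟩, ⟨_, _, one1.symm⟩⟩
      · rw [e10]; exact ⟨⟨_, _, u0.symm⟩, ⟨_, _, u1.symm⟩⟩
      · rw [e01]; exact ⟨⟨_, _, v0.symm⟩, ⟨_, _, v1.symm⟩⟩
      · rw [e11]; exact ⟨⟨_, _, uv0.symm⟩, ⟨_, _, uv1.symm⟩⟩
    · rintro ⟨⟨α, β, f0⟩, ⟨γ, δ, f1⟩⟩
      obtain ⟨g1, rfl, g3⟩ := h1 φ α β γ δ f0.symm f1.symm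
      rcases g1 with rfl | rfl <;> rcases g3 with ⟨rfl, rfl⟩ | ⟨rfl, rfl⟩
      · exact ⟨_, e00.trans (h3 _ _ (one0.trans f0) (one1.trans f1))⟩
      · exact ⟨_, e01.trans (h3 _ _ (v0.trans f0) (v1.trans f1))⟩
      · exact ⟨_, e10.trans (h3 _ _ (u0.trans f0) (u1.trans f1))⟩
      · exact ⟨_, e11.trans (h3 _ _ (uv0.trans f0) (uv1.trans f1))⟩
end

section
/- Let n, m ≥ 2, s ≠ (m+1)/2 and r = (n+1)/2 (so n is odd). With R = ℤ[x₁,x₂]/⟨x₁·∏_{i=1}^n (x₁ + b_i·x₂), x₂·∏_{j=1}^m (a_j·x₁ + x₂)⟩ where b has r ones and a has s twos (rest zeros), the group of graded ring automorphisms of R is exactly {I, −I, (−1,−1;0,1), (1,1;0,−1)} ≅ ℤ/2 × ℤ/2. -/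
open MvPolynomial

section Helpers

/-- Evaluation of a polynomial at the line `T ↦ (x T, y T)`. -/
noncomputable def lineEval {S : Type} [CommRing S] (x y : S) :
    MvPolynomial (Fin 2) ℤ →+* Polynomial S :=
  eval₂Hom (Int.castRingHom (Polynomial S)) ![Polynomial.C x * Polynomial.X, Polynomial.C y * Polynomial.X]

lemma lineEval_X0 {S : Type} [CommRing S] (x y : S) :
    lineEval x y (X 0) = Polynomial.C x * Polynomial.X := by
  simp [lineEval]

lemma lineEval_X1 {S : Type} [CommRing S] (x y : S) :
    lineEval x y (X 1) = Polynomial.C y * Polynomial.X := by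
  simp [lineEval]

lemma lineEval_C {S : Type} [CommRing S] (x y : S) (c : ℤ) :
    lineEval x y (C c) = Polynomial.C (c : S) := by
  simp [lineEval]

lemma lineEval_coeff_zero {S : Type} [CommRing S] (x y : S) (A : MvPolynomial (Fin 2) ℤ) :
    (lineEval x y A).coeff 0 = ((constantCoeff A : ℤ) : S) := by
  have : (Polynomial.constantCoeff.comp (lineEval x y)) =
      (Int.castRingHom S).comp (constantCoeff (σ := Fin 2) (R := ℤ)) := by
    apply MvPolynomial.ringHom_ext
    · intro c; simp
    · intro i; fin_cases i
      · simp [lineEval_X0]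
      · simp [lineEval_X1]
  exact congrArg (fun k => k A) this

/-- The form `x^r (x+y)^r`. -/
def ff {S : Type} [CommRing S] (r : ℕ) (x y : S) : S := x ^ r * (x + y) ^ r

/-- The form `y^t (2x+y)^s`. -/
def hh {S : Type} [CommRing S] (t s : ℕ) (x y : S) : S := y ^ t * (2 * x + y) ^ s

lemma map_ff {S S' : Type} [CommRing S] [CommRing S'] (k : S →+* S') (r : ℕ) (x y : S) :
    k (ff r x y) = ff r (k x) (k y) := by simp [ff]

lemma map_hh {S S' : Type} [CommRing S] [CommRing S'] (k : S →+* S') (t s : ℕ) (x y : S) :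
    k (hh t s x y) = hh t s (k x) (k y) := by simp [hh, map_ofNat]

lemma ff_line {S : Type} [CommRing S] (r : ℕ) (x y : S) :
    ff r (Polynomial.C x * Polynomial.X) (Polynomial.C y * Polynomial.X) =
      Polynomial.C (ff r x y) * Polynomial.X ^ (2 * r) := by
  simp only [ff, map_mul, map_pow, map_add]
  rw [← add_mul, mul_pow, mul_pow]; ring

lemma hh_line {S : Type} [CommRing S] (t s : ℕ) (x y : S) :
    hh t s (Polynomial.C x * Polynomial.X) (Polynomial.C y * Polynomial.X) =
      Polynomial.C (hh t s x y) * Polynomial.X ^ (t + s) := by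
  simp only [hh, map_mul, map_pow, map_add]
  rw [← mul_assoc, ← add_mul, mul_pow, mul_pow, pow_add]
  have : (Polynomial.C (2 : S)) = 2 := map_ofNat _ 2
  rw [this]; ring

lemma lineEval_lin {S : Type} [CommRing S] (x y : S) (p q : ℤ) :
    lineEval x y (C p * X 0 + C q * X 1) =
      Polynomial.C (p * x + q * y) * Polynomial.X := by
  simp only [map_add, map_mul, lineEval_X0, lineEval_X1, lineEval_C]; ring

lemma ev_f {S : Type} [CommRing S] (x y : S) {r s t : ℕ} {p q u v : ℤ}
    {A B : MvPolynomial (Fin 2) ℤ}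
    (h : ff r (C p * X 0 + C q * X 1) (C u * X 0 + C v * X 1) =
      A * ff r (X 0) (X 1) + B * hh t s (X 0) (X 1)) :
    Polynomial.C (ff r (p * x + q * y) (u * x + v * y)) * Polynomial.X ^ (2 * r) =
      lineEval x y A * Polynomial.C (ff r x y) * Polynomial.X ^ (2 * r) +
      lineEval x y B * Polynomial.C (hh t s x y) * Polynomial.X ^ (t + s) := by
  have := congrArg (lineEval x y) h
  rw [map_add, map_mul, map_mul] at this
  simp only [map_ff (lineEval x y), map_hh (lineEval x y), lineEval_lin, lineEval_X0, lineEval_X1,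
    ff_line, hh_line] at this
  rw [this]; ring

lemma ev_h {S : Type} [CommRing S] (x y : S) {r s t : ℕ} {p q u v : ℤ}
    {A B : MvPolynomial (Fin 2) ℤ}
    (h : hh t s (C p * X 0 + C q * X 1) (C u * X 0 + C v * X 1) =
      A * ff r (X 0) (X 1) + B * hh t s (X 0) (X 1)) :
    Polynomial.C (hh t s (p * x + q * y) (u * x + v * y)) * Polynomial.X ^ (t + s) =
      lineEval x y A * Polynomial.C (ff r x y) * Polynomial.X ^ (2 * r) +
      lineEval x y B * Polynomial.C (hh t s x y) * Polynomial.X ^ (t + s) := by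
  have := congrArg (lineEval x y) h
  rw [map_add, map_mul, map_mul] at this
  simp only [map_ff (lineEval x y), map_hh (lineEval x y), lineEval_lin, lineEval_X0, lineEval_X1,
    ff_line, hh_line] at this
  rw [this]; ring

/-- coefficient extraction, low-degree part -/
lemma coeff_low {S : Type} [CommRing S] {a b c : S} {P Q : Polynomial S} {k l : ℕ}
    (hkl : k < l)
    (h : Polynomial.C a * Polynomial.X ^ k =
      P * Polynomial.C b * Polynomial.X ^ k + Q * Polynomial.C c * Polynomial.X ^ l) :
    a = P.coeff 0 * b := by
  have := congrArg (fun z => Polynomial.coeff z k) h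
  simpa [Polynomial.coeff_mul_X_pow', hkl.not_ge] using this

lemma coeff_eq {S : Type} [CommRing S] {a b c : S} {P Q : Polynomial S} {k l : ℕ}
    (hkl : k = l)
    (h : Polynomial.C a * Polynomial.X ^ k =
      P * Polynomial.C b * Polynomial.X ^ k + Q * Polynomial.C c * Polynomial.X ^ l) :
    a = P.coeff 0 * b + Q.coeff 0 * c := by
  subst hkl
  have := congrArg (fun z => Polynomial.coeff z k) h
  simpa [Polynomial.coeff_mul_X_pow'] using this

lemma unit_det {p v : ℤ} (h : p * v = 1 ∨ p * v = -1) :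
    (p = 1 ∨ p = -1) ∧ (v = 1 ∨ v = -1) := by
  have hp : IsUnit p := by
    rcases h with h | h
    · exact IsUnit.of_mul_eq_one v h
    · exact IsUnit.of_mul_eq_one (-v) (by linarith)
  have hv : IsUnit v := by
    rcases h with h | h
    · exact IsUnit.of_mul_eq_one p (by linarith)
    · exact IsUnit.of_mul_eq_one (-p) (by linarith)
  exact ⟨Int.isUnit_iff.1 hp, Int.isUnit_iff.1 hv⟩

lemma swap_id {S : Type} [CommRing S] (t s : ℕ) (v q e : S) :
    hh t s (-v * e + q * 1) (2 * v * e + v * 1) =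
      v ^ t * (2 * q + v) ^ s * (1 + 2 * e) ^ t := by
  simp only [hh]
  rw [show 2 * v * e + v * 1 = v * (1 + 2 * e) by ring,
    show 2 * (-v * e + q * 1) + v * (1 + 2 * e) = 2 * q + v by ring, mul_pow]
  ring

open DualNumber in
/-- The bad substitutions, exchanging `y` and `2x+y` up to sign. -/
lemma no_swap {r s t : ℕ} (hr : 2 ≤ r) (hst : s ≠ t) {p q u v : ℤ}
    {A B : MvPolynomial (Fin 2) ℤ}
    (h : hh t s (C p * X 0 + C q * X 1) (C u * X 0 + C v * X 1) =
      A * ff r (X 0) (X 1) + B * hh t s (X 0) (X 1))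
    (h1 : p = -v) (h2 : u = 2 * v) (h3 : v = 1 ∨ v = -1) (h4 : 2 * q + v = 1 ∨ 2 * q + v = -1) :
    False := by
  have e := ev_h (S := DualNumber ℤ) ε 1 h
  have hf : ff r (ε : DualNumber ℤ) 1 = 0 := by
    obtain ⟨k, rfl⟩ := Nat.exists_eq_add_of_le hr
    simp [ff, pow_add, pow_two, DualNumber.eps_mul_eps]
  rw [hf] at e
  have e2 : hh t s ((p : DualNumber ℤ) * ε + (q : DualNumber ℤ) * 1) ((u : DualNumber ℤ) * ε + (v : DualNumber ℤ) * 1) =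
      ((constantCoeff B : ℤ) : DualNumber ℤ) * hh t s ε 1 := by
    have := congrArg (fun z => Polynomial.coeff z (t + s)) e
    simpa [Polynomial.coeff_mul_X_pow', lineEval_coeff_zero] using this
  have e3 := congrArg TrivSqZeroExt.fst e2
  have e4 := congrArg TrivSqZeroExt.snd e2
  have w1 : (v : ℤ) * v = 1 := by rcases h3 with h | h <;> simp [h]
  set w := 2 * q + v with hw
  have hvw : ∀ c : ℤ, (c = 1 ∨ c = -1) → c ≠ 0 := by rintro c (h|h) <;> simp [h]
  subst h1 h2
  have q1 : hh t s (((-v : ℤ) : DualNumber ℤ) * ε + (q : DualNumber ℤ) * 1) (((2 * v : ℤ) : DualNumber ℤ) * ε + (v : DualNumber ℤ) * 1) =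
     ((v ^ t * w ^ s : ℤ) : DualNumber ℤ) * ((1 + 2 * ε) ^ t) := by
    rw [hw]; push_cast; exact swap_id _ _ _ _ _
  rw [q1] at e3 e4
  have n1 : v ^ t * w ^ s ≠ 0 := mul_ne_zero (pow_ne_zero _ (hvw _ h3)) (pow_ne_zero _ (hvw _ h4))
  simp only [hh, one_pow, one_mul, TrivSqZeroExt.fst_mul, TrivSqZeroExt.snd_mul, TrivSqZeroExt.fst_pow,
    TrivSqZeroExt.snd_pow, TrivSqZeroExt.fst_add, TrivSqZeroExt.snd_add] at e3 e4
  have t2 : (2 : DualNumber ℤ) = ((2 : ℤ) : DualNumber ℤ) := by norm_cast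
  simp [t2, -Int.cast_ofNat] at e3 e4
  rw [← e3] at e4
  have := mul_left_cancel₀ n1 e4
  omega

open DualNumber in
lemma wronsk {r s t : ℕ} (hr : 2 ≤ r) {p q u v α β : ℤ}
    (h : ∀ x y : DualNumber ℤ, ff r ((p : DualNumber ℤ) * x + (q : DualNumber ℤ) * y)
      ((u : DualNumber ℤ) * x + (v : DualNumber ℤ) * y) = (α : DualNumber ℤ) * ff r x y +
        (β : DualNumber ℤ) * hh (t + 1) (s + 1) x y) :
    β * ((-p) ^ t * (2 * q - p) ^ s * ((t + 1) * (2 * q - p) ^ 2 + (s + 1) * p ^ 2)) = 0 := by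
  have key : ∀ (S : Type) [CommRing S] (e P Q U V : S), e * e = 0 →
      ff r (P * (Q * (1 - e)) + Q * (-P + (2 * Q - P) * e))
        (U * (Q * (1 - e)) + V * (-P + (2 * Q - P) * e)) = 0 := by
    intro S _ e P Q U V he
    obtain ⟨k, rfl⟩ := Nat.exists_eq_add_of_le hr
    simp only [ff]
    rw [show P * (Q * (1 - e)) + Q * (-P + (2 * Q - P) * e) = e * (Q * (2 * Q - 2 * P)) by ring,
      mul_pow, pow_add, pow_two e, he]
    ring
  have key2 : ∀ (S : Type) [CommRing S] (e P Q : S), e * e = 0 →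
      ff r (Q * (1 - e)) (-P + (2 * Q - P) * e) = ff r Q (-P) := by
    intro S _ e P Q he
    simp only [ff]
    rw [← mul_pow, ← mul_pow]
    congr 1
    linear_combination (-Q * (Q - P)) * he
  have e := h ((q : DualNumber ℤ) * (1 - ε))
    (-(p : DualNumber ℤ) + (2 * (q : DualNumber ℤ) - (p : DualNumber ℤ)) * ε)
  rw [key _ _ _ _ _ _ (DualNumber.eps_mul_eps), key2 _ _ _ _ (DualNumber.eps_mul_eps)] at e
  have e4 := congrArg TrivSqZeroExt.snd e
  have t2 : (2 : DualNumber ℤ) = ((2 : ℤ) : DualNumber ℤ) := by norm_cast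
  simp only [ff, hh, t2, TrivSqZeroExt.fst_mul, TrivSqZeroExt.snd_mul, TrivSqZeroExt.fst_pow,
    TrivSqZeroExt.snd_pow, TrivSqZeroExt.fst_add, TrivSqZeroExt.snd_add] at e4
  simp [-Int.cast_ofNat] at e4
  rcases e4 with e4 | e4
  · simp [e4]
  · rw [← sub_eq_add_neg] at e4
    linear_combination β * e4

set_option maxHeartbeats 1000000 in
lemma core {r s t : ℕ} (hr : 2 ≤ r) (hs : 1 ≤ s) (ht : 1 ≤ t) (hst : s ≠ t) {p q u v : ℤ}
    (hd : p * v - q * u = 1 ∨ p * v - q * u = -1)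
    {A B A' B' : MvPolynomial (Fin 2) ℤ}
    (hF : ff r (C p * X 0 + C q * X 1) (C u * X 0 + C v * X 1) =
      A * ff r (X 0) (X 1) + B * hh t s (X 0) (X 1))
    (hH : hh t s (C p * X 0 + C q * X 1) (C u * X 0 + C v * X 1) =
      A' * ff r (X 0) (X 1) + B' * hh t s (X 0) (X 1)) :
    u = 0 ∧ ((p = 1 ∧ q = 0 ∧ v = 1) ∨ (p = -1 ∧ q = 0 ∧ v = -1) ∨ (p = -1 ∧ q = -1 ∧ v = 1) ∨
      (p = 1 ∧ q = 1 ∧ v = -1)) := by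
  have hs0 : s ≠ 0 := by omega
  have ht0 : t ≠ 0 := by omega
  have hr0 : r ≠ 0 := by omega
  -- what to do once the pencil member is `f` itself
  have main : ∀ α : ℤ, (∀ x y : ℤ, ff r (p * x + q * y) (u * x + v * y) = α * ff r x y) →
      u = 0 ∧ ((p = 1 ∧ q = 0 ∧ v = 1) ∨ (p = -1 ∧ q = 0 ∧ v = -1) ∨
        (p = -1 ∧ q = -1 ∧ v = 1) ∨ (p = 1 ∧ q = 1 ∧ v = -1)) := by
    intro α h
    have a1 := h 0 1
    have a2 := h 1 (-1)
    simp [ff, hr0] at a1 a2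
    rcases a1 with a1 | a1
    · subst a1
      obtain ⟨hp, hv⟩ := unit_det (p := p) (v := v) (by simpa using hd)
      have : p + u - v = 0 := by
        rcases a2 with a2 | a2
        · omega
        · linarith
      by_cases hpv : p = -v
      · exact (no_swap hr hst hH hpv (by omega) hv (by omega)).elim
      · omega
    · have hq : q = -v := by linarith
      subst hq
      rcases a2 with a2 | a2
      · have hp : p = -v := by linarith
        subst hp
        obtain ⟨hp, hv⟩ := unit_det (p := v) (v := u - v) (by
          rcases hd with h | h
          · left; linarith
          · right; linarith)
        by_cases huv : u = 2 * v
        · exact (no_swap hr hst hH rfl huv hp (by omega)).elim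
        · omega
      · have hu : u = -p := by linarith
        subst hu
        exfalso
        rcases hd with h | h <;> ring_nf at h <;> omega
  rcases lt_trichotomy (2 * r) (t + s) with hlt | heq | hgt
  · apply main (constantCoeff A)
    intro x y
    have := coeff_low hlt (ev_f x y hF)
    simpa [lineEval_coeff_zero] using this
  · have hall : ∀ {S : Type} [CommRing S] (x y : S),
        ff r ((p : S) * x + (q : S) * y) ((u : S) * x + (v : S) * y) =
        ((constantCoeff A : ℤ) : S) * ff r x y + ((constantCoeff B : ℤ) : S) * hh t s x y := by
      intro S _ x y
      have := coeff_eq heq (ev_f x y hF)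
      simpa [lineEval_coeff_zero] using this
    generalize constantCoeff A = α at hall
    generalize constantCoeff B = β at hall
    have hallZ : ∀ x y : ℤ, ff r (p * x + q * y) (u * x + v * y) =
        α * ff r x y + β * hh t s x y := by
      intro x y
      simpa using hall x y
    by_cases hβ : β = 0
    · apply main α
      intro x y
      simpa [hβ] using hallZ x y
    exfalso
    have hα : α = 0 := by
      obtain ⟨s, rfl⟩ := Nat.exists_eq_add_of_le' hs
      obtain ⟨t, rfl⟩ := Nat.exists_eq_add_of_le' ht
      have w := wronsk hr hall
      have z := hallZ q (-p)
      have z0 : ff r (p * q + q * -p) (u * q + v * -p) = 0 := by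
        simp only [ff]
        rw [show p * q + q * -p = 0 by ring, zero_pow hr0, zero_mul]
      rw [z0] at z
      have pos : (p = 0 ∧ q ≠ 0) ∨ (2 * q - p = 0 ∧ q ≠ 0) := by
        have hq : ¬ (p = 0 ∧ q = 0) := by
          rintro ⟨rfl, rfl⟩; simp at hd
        by_contra hcon
        have hp : p ≠ 0 := by
          intro h; apply hcon; left; exact ⟨h, fun h' => hq ⟨h, h'⟩⟩
        have hw : 2 * q - p ≠ 0 := by
          intro h; apply hcon; right; refine ⟨h, fun h' => hp (by omega)⟩
        have : 0 < ((t : ℤ) + 1) * (2 * q - p) ^ 2 + (s + 1) * p ^ 2 := by positivity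
        exact (mul_ne_zero hβ (mul_ne_zero (mul_ne_zero (pow_ne_zero _ (neg_ne_zero.2 hp))
          (pow_ne_zero _ hw)) this.ne')) w
      rcases pos with ⟨h1, h2⟩ | ⟨h1, h2⟩
      · subst h1
        simpa [ff, hh, h2] using z
      · have h1 : p = 2 * q := by linarith
        subst h1
        have : q + -(2 * q) ≠ 0 := by omega
        simpa [ff, hh, h2, this] using z
    subst hα
    have a1 := hallZ 1 0
    have a2 := hallZ 1 (-2)
    simp [ff, hh, hr0, ht0, hs0] at a1 a2
    have ev : ∃ k, p * v - q * u = 2 * k := by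
      rcases a1 with a1 | a1
      · subst a1
        rcases a2 with a2 | a2
        · have : q = 0 := by omega
          subst this
          exact ⟨0, by ring⟩
        · have : u = 2 * (q + v) := by linarith
          subst this
          exact ⟨-q * (q + v), by ring⟩
      · have : u = -p := by linarith
        subst this
        rcases a2 with a2 | a2
        · have : p = 2 * q := by linarith
          subst this
          exact ⟨q * v + q * q, by ring⟩
        · have : v = -q := by linarith
          subst this
          exact ⟨0, by ring⟩
    obtain ⟨k, hk⟩ := ev
    omega
  · have h : ∀ x y : ℤ, hh t s (p * x + q * y) (u * x + v * y) =
        constantCoeff B' * hh t s x y := by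
      intro x y
      have e := ev_h x y hH
      have := coeff_low hgt (e.trans (add_comm _ _))
      simpa [lineEval_coeff_zero] using this
    have a1 := h 1 0
    have a2 := h 1 (-2)
    simp [hh, ht0, hs0] at a1 a2
    rcases a1 with a1 | a1
    · subst a1
      obtain ⟨hp, hv⟩ := unit_det (p := p) (v := v) (by simpa using hd)
      omega
    · have hu : u = -(2 * p) := by linarith
      subst hu
      have hv : v = -p := by
        rcases a2 with a2 | a2
        · linarith
        · have : v = - 2 * q := by linarith
          subst this
          exfalso
          rcases hd with h | h <;> ring_nf at h <;> omega
      subst hv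
      obtain ⟨hp, hv⟩ := unit_det (p := p) (v := 2 * q - p) (by
          rcases hd with h | h
          · left; linarith
          · right; linarith)
      exact (no_swap hr hst hH (by ring) (by ring) (by omega) (by omega)).elim


lemma ff_neg {S : Type} [CommRing S] {r : ℕ} {x y : S} (h : ff r x y = 0) :
    ff r (-x) (-y) = 0 := by
  simp only [ff] at h ⊢
  rw [← neg_add, neg_pow, neg_pow (_ + _)]
  linear_combination ((-1) ^ r * (-1) ^ r) * h

lemma hh_neg {S : Type} [CommRing S] {t s : ℕ} {x y : S} (h : hh t s x y = 0) :
    hh t s (-x) (-y) = 0 := by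
  simp only [hh] at h ⊢
  rw [show 2 * -x + -y = -(2 * x + y) by ring, neg_pow, neg_pow (_ + _)]
  linear_combination ((-1) ^ t * (-1) ^ s) * h

lemma ff_refl {S : Type} [CommRing S] {r : ℕ} {x y : S} (h : ff r x y = 0) :
    ff r (-x - y) y = 0 := by
  simp only [ff] at h ⊢
  rw [show -x - y + y = -x by ring, show -x - y = -(x + y) by ring, neg_pow, neg_pow x]
  linear_combination ((-1) ^ r * (-1) ^ r) * h

lemma hh_refl {S : Type} [CommRing S] {t s : ℕ} {x y : S} (h : hh t s x y = 0) :
    hh t s (-x - y) y = 0 := by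
  simp only [hh] at h ⊢
  rw [show 2 * (-x - y) + y = -(2 * x + y) by ring, neg_pow (_ + _)]
  linear_combination ((-1) ^ s) * h

lemma dual_mul {S : Type} [CommRing S] {e : S} (he : e * e = 0) (c l1 l2 x y z : S) :
    c * (z * e) + (l1 * x * e * (z * e) + l2 * y * e * (z * e)) = c * z * e := by
  linear_combination (l1 * x * z + l2 * y * z) * he

lemma prod_ite_fin {S : Type} [CommRing S] (n r : ℕ) (h : r ≤ n) (x y : S) :
    ∏ i : Fin n, (if (i : ℕ) < r then x else y) = x ^ r * y ^ (n - r) := by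
  rw [Fin.prod_univ_eq_prod_range (fun i => if i < r then x else y) n, Finset.prod_ite]
  have h1 : (Finset.range n).filter (fun i => i < r) = Finset.range r := by
    ext i; simp; omega
  have h2 : (Finset.range n).filter (fun i => ¬ i < r) = Finset.Ico r n := by
    ext i; simp; omega
  rw [h1, h2]; simp

section Ring

variable {n m r s t : ℕ} {a : Fin m → ℤ} {b : Fin n → ℤ}

/-- The two generators of the ideal are `ff` and `hh`. -/
def Good (n m r s t : ℕ) (a : Fin m → ℤ) (b : Fin n → ℤ) : Prop :=
  (X 0 * ∏ i : Fin n, (X 0 + C (b i) * X 1) : MvPolynomial (Fin 2) ℤ) = ff r (X 0) (X 1) ∧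
  (X 1 * ∏ j : Fin m, (C (a j) * X 0 + X 1) : MvPolynomial (Fin 2) ℤ) = hh t s (X 0) (X 1)

lemma rm_ext {S : Type} [CommRing S] {k l : RM n m a b →+* S}
    (h1 : k (z₁ n m a b) = l (z₁ n m a b)) (h2 : k (z₂ n m a b) = l (z₂ n m a b)) : k = l := by
  apply Ideal.Quotient.ringHom_ext
  apply MvPolynomial.ringHom_ext
  · intro c
    simp
  · intro i; fin_cases i
    · exact h1
    · exact h2

lemma rm_lift (hg : Good n m r s t a b) {S : Type} [CommRing S] (x y : S)
    (h1 : ff r x y = 0) (h2 : hh t s x y = 0) :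
    ∃ k : RM n m a b →+* S, k (z₁ n m a b) = x ∧ k (z₂ n m a b) = y := by
  refine ⟨Ideal.Quotient.lift _ (eval₂Hom (Int.castRingHom S) ![x, y]) ?_, ?_, ?_⟩
  · intro P hP
    have : Ideal.span ({X 0 * ∏ i : Fin n, (X 0 + C (b i) * X 1),
      X 1 * ∏ j : Fin m, (C (a j) * X 0 + X 1)} : Set (MvPolynomial (Fin 2) ℤ)) ≤
        RingHom.ker (eval₂Hom (Int.castRingHom S) ![x, y]) := by
      rw [Ideal.span_le, hg.1, hg.2]
      rintro P (rfl | rfl)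
      · simp [RingHom.mem_ker, ff] at h1 ⊢; exact h1
      · simp [RingHom.mem_ker, hh] at h2 ⊢; exact h2
    exact this hP
  · change eval₂Hom (Int.castRingHom S) ![x, y] (X 0) = x
    simp
  · change eval₂Hom (Int.castRingHom S) ![x, y] (X 1) = y
    simp

lemma rm_zero (hg : Good n m r s t a b) {P : MvPolynomial (Fin 2) ℤ}
    (h : (Ideal.Quotient.mk _ P : RM n m a b) = 0) :
    ∃ A B, P = A * ff r (X 0) (X 1) + B * hh t s (X 0) (X 1) := by
  rw [Ideal.Quotient.eq_zero_iff_mem, hg.1, hg.2, Ideal.mem_span_pair] at h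
  obtain ⟨A, B, h⟩ := h
  exact ⟨A, B, h.symm⟩

lemma rm_ff (hg : Good n m r s t a b) : ff r (z₁ n m a b) (z₂ n m a b) = 0 := by
  rw [z₁, z₂, ← map_ff, Ideal.Quotient.eq_zero_iff_mem, ← hg.1]
  exact Ideal.subset_span (by simp)

lemma rm_hh (hg : Good n m r s t a b) : hh t s (z₁ n m a b) (z₂ n m a b) = 0 := by
  rw [z₁, z₂, ← map_hh, Ideal.Quotient.eq_zero_iff_mem, ← hg.2]
  exact Ideal.subset_span (by simp)

lemma mk_lin (p q : ℤ) : (Ideal.Quotient.mk _ (C p * X 0 + C q * X 1) : RM n m a b) =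
    p • z₁ n m a b + q • z₂ n m a b := by
  simp [z₁, z₂, zsmul_eq_mul]

open DualNumber in
/-- The projection on the line through `(x, y)` in the degree-2 part. -/
lemma rm_dual (hg : Good n m r s t a b) (hr : 2 ≤ r) (hts : 2 ≤ t + s) (x y : ℤ) :
    ∃ k : RM n m a b →+* DualNumber ℤ, k (z₁ n m a b) = x • (ε : DualNumber ℤ) ∧
      k (z₂ n m a b) = y • (ε : DualNumber ℤ) := by
  have key : ∀ (S : Type) [CommRing S] (e X Y : S), e * e = 0 → ff r (X * e) (Y * e) = 0 ∧
      hh t s (X * e) (Y * e) = 0 := by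
    intro S _ e X Y he
    constructor
    · obtain ⟨k, rfl⟩ := Nat.exists_eq_add_of_le hr
      simp only [ff, mul_pow, pow_add, pow_two e, he]; ring
    · simp only [hh]
      rw [show 2 * (X * e) + Y * e = (2 * X + Y) * e by ring, mul_pow, mul_pow,
        show Y ^ t * e ^ t * ((2 * X + Y) ^ s * e ^ s) = Y ^ t * (2 * X + Y) ^ s * e ^ (t + s) by
          ring]
      obtain ⟨k, hk⟩ := Nat.exists_eq_add_of_le hts
      rw [hk, pow_add, pow_two, he]; ring
  apply rm_lift hg
  · simpa [zsmul_eq_mul] using (key _ ε (x : DualNumber ℤ) (y : DualNumber ℤ) DualNumber.eps_mul_eps).1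
  · simpa [zsmul_eq_mul] using (key _ ε (x : DualNumber ℤ) (y : DualNumber ℤ) DualNumber.eps_mul_eps).2

open DualNumber in
lemma lin_indep (hg : Good n m r s t a b) (hr : 2 ≤ r) (hts : 2 ≤ t + s) {p q p' q' : ℤ}
    (h : p • z₁ n m a b + q • z₂ n m a b = p' • z₁ n m a b + q' • z₂ n m a b) :
    p = p' ∧ q = q' := by
  obtain ⟨k, k1, k2⟩ := rm_dual hg hr hts 1 0
  obtain ⟨l, l1, l2⟩ := rm_dual hg hr hts 0 1
  have e1 := congrArg TrivSqZeroExt.snd (congrArg k h)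
  have e2 := congrArg TrivSqZeroExt.snd (congrArg l h)
  simp only [map_add, map_zsmul, k1, k2, l1, l2] at e1 e2
  simp at e1 e2
  exact ⟨e1, e2⟩

open DualNumber in
lemma dual_poly (P : MvPolynomial (Fin 2) ℤ) : ∃ c l1 l2 : ℤ,
    ∀ x y : ℤ, eval₂Hom (Int.castRingHom (DualNumber ℤ)) ![x • ε, y • ε] P =
      c • 1 + (l1 * x + l2 * y) • ε := by
  induction P using MvPolynomial.induction_on with
  | C c => exact ⟨c, 0, 0, by intro x y; simp⟩
  | add P Q hP hQ =>
    obtain ⟨c, l1, l2, h⟩ := hP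
    obtain ⟨c', l1', l2', h'⟩ := hQ
    refine ⟨c + c', l1 + l1', l2 + l2', fun x y => ?_⟩
    rw [map_add, h, h']
    module
  | mul_X P i hP =>
    obtain ⟨c, l1, l2, h⟩ := hP
    fin_cases i
    · refine ⟨0, c, 0, fun x y => ?_⟩
      rw [map_mul, h]
      simp [add_mul]
      exact dual_mul DualNumber.eps_mul_eps _ _ _ _ _ _
    · refine ⟨0, 0, c, fun x y => ?_⟩
      rw [map_mul, h]
      simp [add_mul]
      exact dual_mul DualNumber.eps_mul_eps _ _ _ _ _ _

open DualNumber in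
lemma surj_lin (hg : Good n m r s t a b) (hr : 2 ≤ r) (hts : 2 ≤ t + s) {p q u v : ℤ}
    (φ : RingAut (RM n m a b))
    (h1 : φ (z₁ n m a b) = p • z₁ n m a b + q • z₂ n m a b)
    (h2 : φ (z₂ n m a b) = u • z₁ n m a b + v • z₂ n m a b) (w : RM n m a b) :
    ∃ l1 l2 : ℤ, ∀ x y : ℤ, ∀ k : RM n m a b →+* DualNumber ℤ,
      k (z₁ n m a b) = x • (ε : DualNumber ℤ) → k (z₂ n m a b) = y • (ε : DualNumber ℤ) →
      TrivSqZeroExt.snd (k w) = l1 * (p * x + q * y) + l2 * (u * x + v * y) := by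
  obtain ⟨w', rfl⟩ := φ.surjective w
  obtain ⟨P, rfl⟩ := Ideal.Quotient.mk_surjective w'
  obtain ⟨c, l1, l2, h⟩ := dual_poly P
  refine ⟨l1, l2, fun x y k k1 k2 => ?_⟩
  have e : (k.comp (φ : RM n m a b →+* RM n m a b)).comp (Ideal.Quotient.mk _) =
      eval₂Hom (Int.castRingHom (DualNumber ℤ))
        ![(p * x + q * y) • (ε : DualNumber ℤ), (u * x + v * y) • (ε : DualNumber ℤ)] := by
    apply MvPolynomial.ringHom_ext
    · intro c; simp
    · intro i; fin_cases i
      · change k (φ (z₁ n m a b)) = _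
        rw [h1, map_add, map_zsmul, map_zsmul, k1, k2]
        simp [add_smul, mul_assoc]
      · change k (φ (z₂ n m a b)) = _
        rw [h2, map_add, map_zsmul, map_zsmul, k1, k2]
        simp [add_smul, mul_assoc]
  have e' := congrArg (fun z => z P) e
  rw [h] at e'
  have e2 := congrArg TrivSqZeroExt.snd e'
  simpa using e2

lemma det_unit (hg : Good n m r s t a b) (hr : 2 ≤ r) (hts : 2 ≤ t + s) {p q u v : ℤ}
    (φ : RingAut (RM n m a b))
    (h1 : φ (z₁ n m a b) = p • z₁ n m a b + q • z₂ n m a b)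
    (h2 : φ (z₂ n m a b) = u • z₁ n m a b + v • z₂ n m a b) :
    p * v - q * u = 1 ∨ p * v - q * u = -1 := by
  obtain ⟨l1, l2, hl⟩ := surj_lin hg hr hts φ h1 h2 (z₁ n m a b)
  obtain ⟨m1, m2, hm⟩ := surj_lin hg hr hts φ h1 h2 (z₂ n m a b)
  obtain ⟨k, k1, k2⟩ := rm_dual hg hr hts 1 0
  obtain ⟨l, j1, j2⟩ := rm_dual hg hr hts 0 1
  have e1 := hl 1 0 k k1 k2
  have e2 := hl 0 1 l j1 j2
  have e3 := hm 1 0 k k1 k2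
  have e4 := hm 0 1 l j1 j2
  rw [k1] at e1
  rw [k2] at e3
  rw [j1] at e2
  rw [j2] at e4
  simp at e1 e2 e3 e4
  apply Int.isUnit_iff.1
  refine IsUnit.of_mul_eq_one (l1 * m2 - l2 * m1) ?_
  linear_combination -(m1 * q + m2 * v) * e1 + (m1 * p + m2 * u) * e2 - e4

lemma part1 (hg : Good n m r s t a b) (hr : 2 ≤ r) (hs : 1 ≤ s) (ht : 1 ≤ t) (hst : s ≠ t)
    {p q u v : ℤ}
    (φ : RingAut (RM n m a b))
    (h1 : φ (z₁ n m a b) = p • z₁ n m a b + q • z₂ n m a b)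
    (h2 : φ (z₂ n m a b) = u • z₁ n m a b + v • z₂ n m a b) :
    u = 0 ∧ ((p = 1 ∧ q = 0 ∧ v = 1) ∨ (p = -1 ∧ q = 0 ∧ v = -1) ∨ (p = -1 ∧ q = -1 ∧ v = 1) ∨
      (p = 1 ∧ q = 1 ∧ v = -1)) := by
  have hd := det_unit hg hr (by omega) φ h1 h2
  have e1 := congrArg (φ : RM n m a b →+* RM n m a b) (rm_ff hg)
  have e2 := congrArg (φ : RM n m a b →+* RM n m a b) (rm_hh hg)
  rw [map_ff, map_zero] at e1
  rw [map_hh, map_zero] at e2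
  change ff r (φ _) (φ _) = 0 at e1
  change hh t s (φ _) (φ _) = 0 at e2
  rw [h1, h2, ← mk_lin, ← mk_lin, ← map_ff] at e1
  rw [h1, h2, ← mk_lin, ← mk_lin, ← map_hh] at e2
  obtain ⟨A, B, hF⟩ := rm_zero hg e1
  obtain ⟨A', B', hH⟩ := rm_zero hg e2
  exact core hr hs ht hst hd hF hH

/-- An involution from a ring endomorphism. -/
lemma rm_invol (k : RM n m a b →+* RM n m a b)
    (h1 : k (k (z₁ n m a b)) = z₁ n m a b) (h2 : k (k (z₂ n m a b)) = z₂ n m a b) :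
    ∃ φ : RingAut (RM n m a b), φ * φ = 1 ∧ ∀ x, φ x = k x := by
  have : k.comp k = RingHom.id _ := rm_ext h1 h2
  refine ⟨RingEquiv.ofRingHom k k this this, ?_, fun x => rfl⟩
  ext x
  exact congrArg (fun z => z x) this

lemma aut_ext {φ ψ : RingAut (RM n m a b)}
    (h1 : φ (z₁ n m a b) = ψ (z₁ n m a b)) (h2 : φ (z₂ n m a b) = ψ (z₂ n m a b)) : φ = ψ := by
  have : (φ : RM n m a b →+* RM n m a b) = ψ := rm_ext h1 h2
  ext x
  exact congrArg (fun z => z x) this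

lemma exists_neg (hg : Good n m r s t a b) : ∃ φ : RingAut (RM n m a b), φ * φ = 1 ∧
    φ (z₁ n m a b) = -z₁ n m a b ∧ φ (z₂ n m a b) = -z₂ n m a b := by
  obtain ⟨k, k1, k2⟩ := rm_lift hg (-z₁ n m a b) (-z₂ n m a b) (ff_neg (rm_ff hg))
    (hh_neg (rm_hh hg))
  obtain ⟨φ, hφ, h⟩ := rm_invol k (by simp [k1]) (by simp [k2])
  exact ⟨φ, hφ, by rw [h, k1], by rw [h, k2]⟩

lemma exists_refl (hg : Good n m r s t a b) : ∃ φ : RingAut (RM n m a b), φ * φ = 1 ∧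
    φ (z₁ n m a b) = -z₁ n m a b - z₂ n m a b ∧ φ (z₂ n m a b) = z₂ n m a b := by
  obtain ⟨k, k1, k2⟩ := rm_lift hg (-z₁ n m a b - z₂ n m a b) (z₂ n m a b)
    (ff_refl (rm_ff hg)) (hh_refl (rm_hh hg))
  obtain ⟨φ, hφ, h⟩ := rm_invol k (by simp [k1, k2]) (by simp [k2])
  exact ⟨φ, hφ, by rw [h, k1], by rw [h, k2]⟩

end Ring

lemma klein {G : Type} [Group G] (A B : G) (hA : A * A = 1) (hB : B * B = 1) (hAB : A * B = B * A) :
    ∃ e : Multiplicative (ZMod 2 × ZMod 2) →* G,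
      ∀ i j : ZMod 2, e (Multiplicative.ofAdd (i, j)) = A ^ i.val * B ^ j.val := by
  have pA : ∀ i j : ZMod 2, A ^ (i + j).val = A ^ i.val * A ^ j.val := by
    intro i j
    rw [ZMod.val_add, ← pow_add, ← pow_eq_pow_mod _ (by rw [pow_two, hA])]
  have pB : ∀ i j : ZMod 2, B ^ (i + j).val = B ^ i.val * B ^ j.val := by
    intro i j
    rw [ZMod.val_add, ← pow_add, ← pow_eq_pow_mod _ (by rw [pow_two, hB])]
  refine ⟨MonoidHom.mk' (fun z => A ^ (z.toAdd.1).val * B ^ (z.toAdd.2).val) ?_, ?_⟩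
  · intro x y
    simp only [toAdd_mul, Prod.fst_add, Prod.snd_add, pA, pB]
    have hc : Commute (A ^ (y.toAdd.1).val) (B ^ (x.toAdd.2).val) := Commute.pow_pow hAB _ _
    rw [mul_assoc, mul_assoc, ← mul_assoc (A ^ _) (B ^ _) (B ^ _), hc.eq, mul_assoc]
  · intro i j; rfl

end Helpers

/-- Let `n, m ≥ 2`, `a = (2,…,2,0,…,0)` with `s` twos (`1 ≤ s ≤ m`), and
`b = (1,…,1,0,…,0)` with `r` ones (`1 ≤ r ≤ n`), where `s ≠ (m+1)/2` and `r = (n+1)/2`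
(so `n` is odd).  Then the group of graded ring automorphisms of
`R = ℤ[x₁,x₂]/⟨x₁·∏ᵢ(x₁+bᵢx₂), x₂·∏ⱼ(aⱼx₁+x₂)⟩`, identified with 2×2 integer matrices via
the action on the degree-2 part, is exactly `{I, -I, (-1,-1;0,1), (1,1;0,-1)} ≅ ℤ/2 × ℤ/2`. -/
theorem stmt8 (n m r s : ℕ) (hn : 2 ≤ n) (hm : 2 ≤ m)
    (hr1 : 1 ≤ r) (hrn : r ≤ n) (hs1 : 1 ≤ s) (hsm : s ≤ m)
    (hs : 2 * s ≠ m + 1) (hr : 2 * r = n + 1)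
    (a : Fin m → ℤ) (b : Fin n → ℤ)
    (ha : ∀ j : Fin m, a j = if (j : ℕ) < s then 2 else 0)
    (hb : ∀ i : Fin n, b i = if (i : ℕ) < r then 1 else 0) :
    (∀ (φ : RingAut (RM n m a b)) (g : Matrix (Fin 2) (Fin 2) ℤ),
        φ (z₁ n m a b) = g 0 0 • z₁ n m a b + g 0 1 • z₂ n m a b →
        φ (z₂ n m a b) = g 1 0 • z₁ n m a b + g 1 1 • z₂ n m a b →
        g ∈ ({1, -1, !![-1, -1; 0, 1], !![1, 1; 0, -1]} : Set (Matrix (Fin 2) (Fin 2) ℤ))) ∧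
    (∀ g ∈ ({1, -1, !![-1, -1; 0, 1], !![1, 1; 0, -1]} : Set (Matrix (Fin 2) (Fin 2) ℤ)),
        ∃ φ : RingAut (RM n m a b),
          φ (z₁ n m a b) = g 0 0 • z₁ n m a b + g 0 1 • z₂ n m a b ∧
          φ (z₂ n m a b) = g 1 0 • z₁ n m a b + g 1 1 • z₂ n m a b) ∧
    (∃ e : Multiplicative (ZMod 2 × ZMod 2) →* RingAut (RM n m a b),
        Function.Injective e ∧
        ∀ φ : RingAut (RM n m a b), φ ∈ Set.range e ↔ IsGraded n m a b φ) := by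
  obtain ⟨t, ht⟩ : ∃ t, t = m + 1 - s := ⟨_, rfl⟩
  have hg : Good n m r s t a b := by
    constructor
    · have : ∀ i : Fin n, (X 0 + C (b i) * X 1 : MvPolynomial (Fin 2) ℤ) =
          if (i : ℕ) < r then X 0 + X 1 else X 0 := by
        intro i; rw [hb]; split_ifs <;> simp
      simp only [this]
      rw [prod_ite_fin n r hrn, ff]
      have h : r = (n - r) + 1 := by omega
      conv_rhs => rw [mul_comm]; arg 2; rw [h]
      rw [pow_succ]; ring
    · have : ∀ j : Fin m, (C (a j) * X 0 + X 1 : MvPolynomial (Fin 2) ℤ) =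
          if (j : ℕ) < s then 2 * X 0 + X 1 else X 1 := by
        intro i; rw [ha]; split_ifs <;> simp [map_ofNat]
      simp only [this]
      rw [prod_ite_fin m s hsm, hh]
      have h : t = (m - s) + 1 := by omega
      rw [h, pow_succ]; ring
  have hr2 : 2 ≤ r := by omega
  have ht1 : 1 ≤ t := by omega
  have hst : s ≠ t := by omega
  have hts : 2 ≤ t + s := by omega
  obtain ⟨A, hA, A1, A2⟩ := exists_neg hg
  obtain ⟨B, hB, B1, B2⟩ := exists_refl hg
  have hAB : A * B = B * A := by
    apply aut_ext <;> simp [RingAut.mul_apply, A1, A2, B1, B2, add_comm]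
  have four : ∀ (φ : RingAut (RM n m a b)) (p q u v : ℤ),
      φ (z₁ n m a b) = p • z₁ n m a b + q • z₂ n m a b →
      φ (z₂ n m a b) = u • z₁ n m a b + v • z₂ n m a b →
      u = 0 ∧ ((p = 1 ∧ q = 0 ∧ v = 1) ∨ (p = -1 ∧ q = 0 ∧ v = -1) ∨
        (p = -1 ∧ q = -1 ∧ v = 1) ∨ (p = 1 ∧ q = 1 ∧ v = -1)) :=
    fun φ p q u v h1 h2 => part1 hg hr2 hs1 ht1 hst φ h1 h2
  refine ⟨?_, ?_, ?_⟩
  · intro φ g h1 h2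
    have h := four φ _ _ _ _ h1 h2
    rw [Matrix.eta_fin_two g]
    rcases h with ⟨h0, ⟨h1, h2, h3⟩ | ⟨h1, h2, h3⟩ | ⟨h1, h2, h3⟩ | ⟨h1, h2, h3⟩⟩ <;>
      rw [h0, h1, h2, h3]
    · left; exact Matrix.one_fin_two.symm
    · right; left; simp [Matrix.one_fin_two]
    · right; right; left; rfl
    · right; right; right; rfl
  · rintro g (rfl | rfl | rfl | rfl)
    · exact ⟨1, by simp, by simp⟩
    · exact ⟨A, by simp [A1], by simp [A2]⟩
    · exact ⟨B, by simp [B1, sub_eq_add_neg], by simp [B2]⟩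
    · exact ⟨A * B, by simp [RingAut.mul_apply, A1, A2, B1], by simp [RingAut.mul_apply, A2, B2]⟩
  · obtain ⟨e, he⟩ := klein A B hA hB hAB
    have e00 : e (Multiplicative.ofAdd (0, 0)) = 1 := by rw [he]; simp
    have e10 : e (Multiplicative.ofAdd (1, 0)) = A := by rw [he]; simp [ZMod.val_one]
    have e01 : e (Multiplicative.ofAdd (0, 1)) = B := by rw [he]; simp [ZMod.val_one]
    have e11 : e (Multiplicative.ofAdd (1, 1)) = A * B := by rw [he]; simp [ZMod.val_one]
    have all : ∀ z : Multiplicative (ZMod 2 × ZMod 2), z = Multiplicative.ofAdd (0, 0) ∨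
        z = Multiplicative.ofAdd (1, 0) ∨ z = Multiplicative.ofAdd (0, 1) ∨
        z = Multiplicative.ofAdd (1, 1) := by decide
    have AB1 : (A * B) (z₁ n m a b) = z₁ n m a b + z₂ n m a b := by
      simp [RingAut.mul_apply, A1, A2, B1]
    have AB2 : (A * B) (z₂ n m a b) = -z₂ n m a b := by
      simp [RingAut.mul_apply, A2, B2]
    refine ⟨e, ?_, ?_⟩
    · rw [injective_iff_map_eq_one]
      intro z hz
      have c1 : (e z) (z₁ n m a b) = z₁ n m a b := by rw [hz]; rfl
      have c2 : (e z) (z₂ n m a b) = z₂ n m a b := by rw [hz]; rfl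
      have n2 : -z₂ n m a b ≠ z₂ n m a b := by
        intro h
        have := lin_indep hg hr2 hts (p := 0) (q := -1) (p' := 0) (q' := 1) (by simpa using h)
        omega
      rcases all z with rfl | rfl | rfl | rfl
      · rfl
      · rw [e10, A2] at c2; exact (n2 c2).elim
      · rw [e01, B1] at c1
        have := lin_indep hg hr2 hts (p := -1) (q := -1) (p' := 1) (q' := 0)
          (by simpa [sub_eq_add_neg] using c1)
        omega
      · rw [e11, AB2] at c2; exact (n2 c2).elim
    · intro φ
      constructor
      · rintro ⟨z, rfl⟩
        simp only [IsGraded, Submodule.mem_span_pair]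
        rcases all z with rfl | rfl | rfl | rfl
        · rw [e00]; exact ⟨⟨1, 0, by simp⟩, ⟨0, 1, by simp⟩⟩
        · rw [e10]; exact ⟨⟨-1, 0, by simp [A1]⟩, ⟨0, -1, by simp [A2]⟩⟩
        · rw [e01]; exact ⟨⟨-1, -1, by simp [B1, sub_eq_add_neg]⟩, ⟨0, 1, by simp [B2]⟩⟩
        · rw [e11]; exact ⟨⟨1, 1, by simp [AB1]⟩, ⟨0, -1, by simp [AB2]⟩⟩
      · intro h
        simp only [IsGraded, Submodule.mem_span_pair] at h
        obtain ⟨⟨p, q, h1⟩, ⟨u, v, h2⟩⟩ := h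
        obtain ⟨rfl, ⟨rfl, rfl, rfl⟩ | ⟨rfl, rfl, rfl⟩ | ⟨rfl, rfl, rfl⟩ | ⟨rfl, rfl, rfl⟩⟩ :=
          four φ p q u v h1.symm h2.symm
        · exact ⟨_, e00.trans (aut_ext (by simp [← h1]) (by simp [← h2]))⟩
        · exact ⟨_, e10.trans (aut_ext (by simp [← h1, A1]) (by simp [← h2, A2]))⟩
        · exact ⟨_, e01.trans (aut_ext (by simp [← h1, B1, sub_eq_add_neg]) (by simp [← h2, B2]))⟩
        · exact ⟨_, e11.trans (aut_ext (by simp [← h1, AB1]) (by simp [← h2, AB2]))⟩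
end
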